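/- arXiv:math/0111271 — 5 statements merged into one kernel-verified Lean document; each statement's English description precedes it below -/
import Mathlib

section
/- Let p be a prime, F a field of characteristic p, and f ∈ F[X]. Set w := ∂^{p−1}(f^{p−1}), the (p−1)-st derivative of f^{p−1}. Then: (i) w is congruent modulo the ideal (X^p) to the constant polynomial w(0) (its coefficient of X^0), i.e. w − w(0) ∈ (X^p); and (ii) for every h ∈ F[X], (T_f)^p(h) + w(0)·(f·∂h) ∈ (X^p), where T_f(h) = f·∂h. In other words, in Der(F[X]/(X^p)) one has (f∂)^[p] = C(f)·f∂ with C(f) = −∂^{p−1}(f^{p−1}). -/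
open Polynomial TensorProduct

namespace WittPower

/-- In characteristic `p`, the `p`-th power of a derivation satisfies the Leibniz rule. -/
theorem derivation_pow_char_mul {F A : Type*} [Field F] [CommRing A] [Nontrivial A] [Algebra F A]
    (p : ℕ) [Fact p.Prime] [CharP F p] (D : Derivation F A A) (a b : A) :
    ((D : Module.End F A) ^ p) (a * b)
      = a * ((D : Module.End F A) ^ p) b + b * ((D : Module.End F A) ^ p) a := by
  set d : Module.End F A := (D : Module.End F A) with hd
  let l : Module.End F (A ⊗[F] A) := d.rTensor A
  let r : Module.End F (A ⊗[F] A) := d.lTensor A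
  have hcomm : Commute l r := by
    refine TensorProduct.ext' fun x y => ?_
    simp [l, r]
  have : CharP (Module.End F (A ⊗[F] A)) p :=
    charP_of_injective_algebraMap (algebraMap F _).injective p
  have hsemi : ∀ (n : ℕ) (t : A ⊗[F] A),
      LinearMap.mul' F A (((l + r) ^ n) t) = (d ^ n) (LinearMap.mul' F A t) := by
    intro n
    induction n with
    | zero => intro t; simp
    | succ n ih =>
      intro t
      rw [pow_succ, pow_succ, Module.End.mul_apply, Module.End.mul_apply, ih]
      congr 1
      induction t with
      | zero => simp
      | add x y hx hy => simp only [map_add, hx, hy]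
      | tmul x y => simp [l, r, hd]; ring
  have hpow := hsemi p (a ⊗ₜ b)
  rw [add_pow_char_of_commute _ hcomm] at hpow
  simp only [l, r, LinearMap.rTensor_pow, LinearMap.lTensor_pow, LinearMap.add_apply,
    LinearMap.rTensor_tmul, LinearMap.lTensor_tmul, map_add, LinearMap.mul'_apply] at hpow
  rw [← hpow]
  ring

variable {F : Type*} [Field F]

/-- The linear differential operators on `F[X]` of order less than `n`. -/
noncomputable def ordLT (F : Type*) [Field F] (n : ℕ) : Submodule F[X] (Module.End F F[X]) :=
  Submodule.span F[X] ((fun i : ℕ => (derivative : Module.End F F[X]) ^ i) '' Set.Iio n)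

theorem derivative_pow_mem {i n : ℕ} (h : i < n) :
    (derivative : Module.End F F[X]) ^ i ∈ ordLT F n :=
  Submodule.subset_span ⟨i, h, rfl⟩

theorem ordLT_mono {m n : ℕ} (h : m ≤ n) : ordLT F m ≤ ordLT F n :=
  Submodule.span_mono (Set.image_mono (Set.Iio_subset_Iio h))

/-- Composing on the right by `R` maps `ordLT F m` into `ordLT F n` if it does so on powers of the
derivative. -/
theorem mul_mem_of_forall_derivative_pow {m n : ℕ} {R : Module.End F F[X]}
    (hR : ∀ i < m, (derivative : Module.End F F[X]) ^ i * R ∈ ordLT F n)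
    {E : Module.End F F[X]} (hE : E ∈ ordLT F m) : E * R ∈ ordLT F n := by
  induction hE using Submodule.span_induction with
  | mem x hx => obtain ⟨i, hi, rfl⟩ := hx; exact hR i hi
  | zero => simp
  | add x y _ _ hx hy => rw [add_mul]; exact add_mem hx hy
  | smul a x _ hx =>
    have : a • x * R = a • (x * R) := rfl
    rw [this]
    exact Submodule.smul_mem _ a hx

theorem mul_derivative_mem {n : ℕ} {E : Module.End F F[X]} (hE : E ∈ ordLT F n) :
    E * derivative ∈ ordLT F (n + 1) :=
  mul_mem_of_forall_derivative_pow
    (fun i hi => by rw [← pow_succ]; exact derivative_pow_mem (by omega)) hE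

theorem derivative_pow_mul_mulLeft_sub_mem (i : ℕ) (f : F[X]) :
    (derivative : Module.End F F[X]) ^ i * LinearMap.mulLeft F f
      - f • (derivative : Module.End F F[X]) ^ i ∈ ordLT F i := by
  induction i generalizing f with
  | zero =>
    convert zero_mem (ordLT F 0)
    refine LinearMap.ext fun x => ?_
    simp
  | succ i ih =>
    have h : (derivative : Module.End F F[X]) ^ (i + 1) * LinearMap.mulLeft F f
        - f • (derivative : Module.End F F[X]) ^ (i + 1)
        = ((derivative : Module.End F F[X]) ^ i * LinearMap.mulLeft F f
            - f • (derivative : Module.End F F[X]) ^ i) * derivative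
          + (((derivative : Module.End F F[X]) ^ i * LinearMap.mulLeft F (derivative f)
            - derivative f • (derivative : Module.End F F[X]) ^ i)
            + derivative f • (derivative : Module.End F F[X]) ^ i) := by
      refine LinearMap.ext fun x => ?_
      simp only [pow_succ, LinearMap.sub_apply, LinearMap.add_apply, LinearMap.smul_apply,
        Module.End.mul_apply, LinearMap.mulLeft_apply, derivative_mul, map_add]
      ring
    rw [h]
    exact add_mem (mul_derivative_mem (ih f)) (add_mem (ordLT_mono i.le_succ (ih _))
      (Submodule.smul_mem _ _ (derivative_pow_mem i.lt_succ_self)))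

theorem mul_mulLeft_mem {n : ℕ} {E : Module.End F F[X]} (hE : E ∈ ordLT F n) (f : F[X]) :
    E * LinearMap.mulLeft F f ∈ ordLT F n := by
  refine mul_mem_of_forall_derivative_pow (fun i hi => ?_) hE
  have h := add_mem (ordLT_mono hi.le (derivative_pow_mul_mulLeft_sub_mem i f))
    (Submodule.smul_mem _ f (derivative_pow_mem hi))
  rwa [sub_add_cancel] at h

theorem smul_derivative_pow_sub_mem (n : ℕ) (f : F[X]) :
    (f • (derivative : Module.End F F[X])) ^ n
      - f ^ n • (derivative : Module.End F F[X]) ^ n ∈ ordLT F n := by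
  induction n with
  | zero => simp
  | succ n ih =>
    have h : (f • (derivative : Module.End F F[X])) ^ (n + 1)
        - f ^ (n + 1) • (derivative : Module.End F F[X]) ^ (n + 1)
        = (((f • (derivative : Module.End F F[X])) ^ n
            - f ^ n • (derivative : Module.End F F[X]) ^ n) * LinearMap.mulLeft F f) * derivative
          + f ^ n • (((derivative : Module.End F F[X]) ^ n * LinearMap.mulLeft F f
            - f • (derivative : Module.End F F[X]) ^ n) * derivative) := by
      refine LinearMap.ext fun x => ?_
      simp only [pow_succ, LinearMap.sub_apply, LinearMap.add_apply, LinearMap.smul_apply,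
        Module.End.mul_apply, LinearMap.mulLeft_apply, smul_eq_mul]
      ring
    rw [h]
    exact add_mem (mul_derivative_mem (mul_mulLeft_mem ih f))
      (Submodule.smul_mem _ _ (mul_derivative_mem (derivative_pow_mul_mulLeft_sub_mem n f)))

/-- A differential operator of order less than `n ≤ p` is determined by its values on
`1, X, …, X ^ (n - 1)`. -/
theorem eq_zero_of_mem_ordLT (p : ℕ) [Fact p.Prime] [CharP F p] {n : ℕ} (hn : n ≤ p)
    {E : Module.End F F[X]} (hE : E ∈ ordLT F n) (h : ∀ k < n, E (X ^ k) = 0) : E = 0 := by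
  induction n generalizing E with
  | zero => simpa [ordLT] using hE
  | succ n ih =>
    rw [ordLT, Set.Iio_add_one_eq_Iic, ← Set.Iio_insert, Set.image_insert_eq,
      Submodule.mem_span_insert] at hE
    obtain ⟨a, E₀, hE₀, rfl⟩ := hE
    have hE₀_zero : E₀ = 0 := by
      refine ih (by omega) hE₀ fun k hk => ?_
      have hk' := h k (by omega)
      rwa [LinearMap.add_apply, LinearMap.smul_apply, Module.End.pow_apply,
        iterate_derivative_eq_zero ((natDegree_X_pow_le k).trans_lt hk), smul_zero,
        zero_add] at hk'
    subst hE₀_zero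
    have hn' := h n n.lt_succ_self
    have hfac : ((n.factorial : ℕ) : F[X]) ≠ 0 := by
      rw [Ne, CharP.cast_eq_zero_iff F[X] p, (Fact.out : p.Prime).dvd_factorial]
      omega
    have ha : a = 0 := by
      rw [add_zero, LinearMap.smul_apply, Module.End.pow_apply,
        iterate_derivative_X_pow_eq_natCast_mul] at hn'
      simpa [hfac, Nat.descFactorial_self] using hn'
    simp [ha]

theorem smul_derivative_pow_char (p : ℕ) [Fact p.Prime] [CharP F p] (f h : F[X]) :
    ((f • (derivative : Module.End F F[X])) ^ p) h
      = ((f • (derivative : Module.End F F[X])) ^ (p - 1)) f * derivative h := by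
  let D : Derivation F F[X] F[X] := f • derivative'
  have hD : (D : Module.End F F[X]) = f • (derivative : Module.End F F[X]) := rfl
  let Dp : Derivation F F[X] F[X] :=
    Derivation.mk' ((D : Module.End F F[X]) ^ p) (derivation_pow_char_mul p D)
  have hX : ((f • (derivative : Module.End F F[X])) ^ p) X
      = ((f • (derivative : Module.End F F[X])) ^ (p - 1)) f := by
    rw [← Nat.sub_add_cancel (Fact.out : p.Prime).one_le, pow_succ]
    simp
  have key : Dp = ((f • (derivative : Module.End F F[X])) ^ (p - 1)) f • derivative' := by
    refine derivation_ext ?_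
    rw [← hX]
    simp [Dp, hD]
  exact congrArg (fun d : Derivation F F[X] F[X] => d h) key

theorem iterate_derivative_char (p : ℕ) [Fact p.Prime] [CharP F p] (h : F[X]) :
    derivative^[p] h = 0 := by
  have := smul_derivative_pow_char p (1 : F[X]) h
  have hp := (Fact.out : p.Prime).two_le
  rwa [one_smul, Module.End.pow_apply, Module.End.pow_apply,
    iterate_derivative_eq_zero (p := 1) (by rw [natDegree_one]; omega), zero_mul] at this

theorem iterate_derivative_pow_char_mul (p : ℕ) [CharP F p] (n : ℕ) (f u : F[X]) :
    derivative^[n] (f ^ p * u) = f ^ p * derivative^[n] u := by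
  induction n with
  | zero => rfl
  | succ n ih =>
    rw [Function.iterate_succ_apply', ih, Function.iterate_succ_apply', derivative_mul,
      derivative_pow]
    simp

theorem smul_derivative_pow_pow_char_mul (p : ℕ) [CharP F p] (n : ℕ) (f u : F[X]) :
    ((f • (derivative : Module.End F F[X])) ^ n) (f ^ p * u)
      = f ^ p * ((f • (derivative : Module.End F F[X])) ^ n) u := by
  induction n with
  | zero => rfl
  | succ n ih =>
    rw [pow_succ', Module.End.mul_apply, ih, Module.End.mul_apply]
    simp [derivative_pow]
    ring

theorem smul_derivative_pow_pred_char_self (p : ℕ) [Fact p.Prime] [CharP F p] (f : F[X]) :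
    ((f • (derivative : Module.End F F[X])) ^ (p - 1)) f
      = -(f * derivative^[p - 1] (f ^ (p - 1))) := by
  have hp := (Fact.out : p.Prime).two_le
  have hp1 : p - 1 + 1 = p := by omega
  rcases eq_or_ne f 0 with rfl | hf
  · simp
  set g := ((f • (derivative : Module.End F F[X])) ^ (p - 1)) f with hg
  let E : Module.End F F[X] := f • (f • (derivative : Module.End F F[X])) ^ (p - 1)
    - g • (1 : Module.End F F[X])
    - f • ((derivative : Module.End F F[X]) ^ (p - 1) * LinearMap.mulLeft F (f ^ (p - 1)))
  have hE_apply (u : F[X]) : E u = f * ((f • (derivative : Module.End F F[X])) ^ (p - 1)) u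
      - g * u - f * derivative^[p - 1] (f ^ (p - 1) * u) := by
    simp [E, Module.End.pow_apply]
  have hE : E ∈ ordLT F (p - 1) := by
    have h : E = f • ((f • (derivative : Module.End F F[X])) ^ (p - 1)
          - f ^ (p - 1) • (derivative : Module.End F F[X]) ^ (p - 1))
        - g • (derivative : Module.End F F[X]) ^ 0
        - f • ((derivative : Module.End F F[X]) ^ (p - 1) * LinearMap.mulLeft F (f ^ (p - 1))
          - f ^ (p - 1) • (derivative : Module.End F F[X]) ^ (p - 1)) := by
      simp only [E, pow_zero, smul_sub]
      abel
    rw [h]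
    exact sub_mem (sub_mem (Submodule.smul_mem _ _ (smul_derivative_pow_sub_mem _ _))
      (Submodule.smul_mem _ _ (derivative_pow_mem (by omega))))
      (Submodule.smul_mem _ _ (derivative_pow_mul_mulLeft_sub_mem _ _))
  have hE_deriv (v : F[X]) : E (f * derivative v) = 0 := by
    have h₁ : ((f • (derivative : Module.End F F[X])) ^ (p - 1)) (f * derivative v)
        = g * derivative v := by
      rw [hg, ← smul_derivative_pow_char]
      conv_rhs => rw [← hp1, pow_succ]
      simp
    have h₂ : derivative^[p - 1] (f ^ (p - 1) * (f * derivative v)) = 0 := by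
      rw [← mul_assoc, ← pow_succ, hp1, iterate_derivative_pow_char_mul,
        ← Function.iterate_succ_apply, Nat.succ_eq_add_one, hp1, iterate_derivative_char, mul_zero]
    rw [hE_apply, h₁, h₂]
    ring
  have hEf : E * LinearMap.mulLeft F f = 0 := by
    refine eq_zero_of_mem_ordLT p (Nat.sub_le p 1) (mul_mulLeft_mem hE f) fun k hk => ?_
    have hk0 : ((k + 1 : ℕ) : F) ≠ 0 := by
      rw [Ne, CharP.cast_eq_zero_iff F p]
      exact Nat.not_dvd_of_pos_of_lt k.succ_pos (by omega)
    have hX : derivative (C ((k + 1 : ℕ) : F)⁻¹ * X ^ (k + 1)) = (X : F[X]) ^ k := by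
      rw [derivative_C_mul, derivative_X_pow, ← mul_assoc, ← C_mul, inv_mul_cancel₀ hk0]
      simp
    rw [Module.End.mul_apply, LinearMap.mulLeft_apply, ← hX]
    exact hE_deriv _
  -- `f ^ p` is a constant for the derivation, so `E (f ^ p) = f ^ p * E 1`.
  have hE1 : f ^ p * E 1 = 0 := by
    have h := congrArg (fun L : Module.End F F[X] => L (f ^ (p - 1) * 1)) hEf
    simp only [Module.End.mul_apply, LinearMap.mulLeft_apply, LinearMap.zero_apply] at h
    rw [← mul_assoc, ← pow_succ', hp1, hE_apply, smul_derivative_pow_pow_char_mul,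
      mul_left_comm (f ^ (p - 1)), iterate_derivative_pow_char_mul] at h
    rw [hE_apply, ← h]
    ring
  have hT1 : ((f • (derivative : Module.End F F[X])) ^ (p - 1)) 1 = 0 := by
    obtain ⟨m, hm⟩ : ∃ m, p - 1 = m + 1 := ⟨p - 2, by omega⟩
    rw [hm, pow_succ]
    simp
  have h := (mul_eq_zero.mp hE1).resolve_left (pow_ne_zero p hf)
  rw [hE_apply, hT1, mul_one, mul_one, mul_zero] at h
  linear_combination -h

theorem sub_C_coeff_zero_mem_of_derivative_eq_zero (p : ℕ) [CharP F p] {w : F[X]}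
    (h : derivative w = 0) : w - C (w.coeff 0) ∈ Ideal.span {(X : F[X]) ^ p} := by
  rw [Ideal.mem_span_singleton, X_pow_dvd_iff]
  intro d hd
  rcases d with _ | d
  · simp
  · have hcoeff := congrArg (fun q : F[X] => q.coeff d) h
    simp only [coeff_derivative, coeff_zero] at hcoeff
    have hne : ((d : F) + 1) ≠ 0 := by
      rw [← Nat.cast_succ, Ne, CharP.cast_eq_zero_iff F p]
      exact Nat.not_dvd_of_pos_of_lt d.succ_pos hd
    simpa [coeff_C, hne] using hcoeff

end WittPower

theorem witt_pth_power_constant_eq_neg_deriv (p : ℕ) (hp : p.Prime) (F : Type*) [Field F]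
    [CharP F p] (f : Polynomial F)
    (w : Polynomial F)
    (hw : w = (Polynomial.derivative (R := F))^[p - 1] (f ^ (p - 1))) :
    (w - Polynomial.C (w.coeff 0) ∈ Ideal.span {(Polynomial.X : Polynomial F) ^ p}) ∧
    (∀ h : Polynomial F,
      (fun h : Polynomial F => f * Polynomial.derivative h)^[p] h
          + Polynomial.C (w.coeff 0) * (f * Polynomial.derivative h)
        ∈ Ideal.span {(Polynomial.X : Polynomial F) ^ p}) := by
  have : Fact p.Prime := ⟨hp⟩
  have hw_mem : w - C (w.coeff 0) ∈ Ideal.span {(X : F[X]) ^ p} := by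
    refine WittPower.sub_C_coeff_zero_mem_of_derivative_eq_zero p ?_
    rw [hw, ← Function.iterate_succ_apply' derivative, Nat.succ_eq_add_one, Nat.sub_add_cancel hp.one_le,
      WittPower.iterate_derivative_char]
  refine ⟨hw_mem, fun h => ?_⟩
  have hT : (fun h : F[X] => f * derivative h)^[p] h = -(f * w) * derivative h := by
    rw [hw, ← WittPower.smul_derivative_pow_pred_char_self, ← WittPower.smul_derivative_pow_char,
      Module.End.pow_apply]
    rfl
  have heq : -(f * w) * derivative h + C (w.coeff 0) * (f * derivative h)
      = -(f * derivative h) * (w - C (w.coeff 0)) := by ring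
  rw [hT, heq]
  exact Ideal.mul_mem_left _ _ hw_mem
end

section
/- Let p be a prime, A a commutative ring of characteristic p, D : A → A a derivation (a ℤ-linear map satisfying the Leibniz rule D(ab) = a·D(b) + b·D(a)), and f ∈ A. Let S : A → A be the map u ↦ D(f·u). Then S^{p−1}(1) = −D^{p−1}(f^{p−1}), where S^{p−1} and D^{p−1} denote (p−1)-fold iterates. (This is the identity (∂f)^{p−1} ≡ −∂^{p−1}f^{p−1} mod p of differential expressions, where (∂f)^{p−1} denotes the word ∂f∂f…∂f with p−1 letters ∂ and p−1 letters f, interpreted as ∂(f·∂(f·…·∂(f)…)).) -/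
open Polynomial

/-- In a ring where the prime `p` vanishes, `ad(m) ^ p = ad(m ^ p)`. -/
theorem mulLeft_sub_mulRight_pow_prime_apply {R : Type*} [Ring R] {p : ℕ} (hp : p.Prime)
    (hR : (p : R) = 0) (m x : R) :
    ((LinearMap.mulLeft ℤ m - LinearMap.mulRight ℤ m) ^ p) x = m ^ p * x - x * m ^ p := by
  have hcomm : Commute (LinearMap.mulLeft ℤ m - LinearMap.mulRight ℤ m)
      (LinearMap.mulRight ℤ m) :=
    (LinearMap.commute_mulLeft_right m m).sub_left (Commute.refl _)
  obtain ⟨r, hr⟩ := hcomm.exists_add_pow_prime_eq hp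
  have h := LinearMap.congr_fun hr x
  rw [sub_add_cancel, LinearMap.pow_mulLeft, LinearMap.pow_mulRight, mul_assoc, mul_assoc] at h
  simp only [LinearMap.mulLeft_apply, LinearMap.add_apply, LinearMap.mulRight_apply,
    Module.End.mul_apply, Module.End.natCast_apply] at h
  rw [h, ← Nat.cast_smul_eq_nsmul R, hR, zero_smul]
  abel

section RegularCase

variable {A : Type*} [CommRing A] (D : Derivation ℤ A A) (f : A)

/-- The derivation of `A[X]` that applies `D` to every coefficient. -/
noncomputable def coeffDerivation : Derivation ℤ A[X] A[X] :=
  letI : Differential A := ⟨D⟩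
  Differential.mapCoeffs

@[simp]
theorem coeff_coeffDerivation (g : A[X]) (n : ℕ) :
    (coeffDerivation D g).coeff n = D (g.coeff n) :=
  rfl

@[simp]
theorem coeffDerivation_C (a : A) : coeffDerivation D (C a) = C (D a) := by
  ext n
  simp [coeff_C, apply_ite D]

theorem coeffDerivation_X_mul (g : A[X]) :
    coeffDerivation D (X * g) = X * coeffDerivation D g := by
  ext n
  cases n <;> simp only [coeff_coeffDerivation, coeff_X_mul, coeff_X_mul_zero, map_zero]

theorem derivative_coeffDerivation (g : A[X]) :
    derivative (coeffDerivation D g) = coeffDerivation D (derivative g) := by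
  ext n
  simp [coeff_derivative, Derivation.leibniz, mul_comm]

/-- The operator `u ↦ (D + X)(f u)` on `A[X]`, the symbol of `u ↦ D (f u)`. -/
noncomputable def symbolStep : Module.End ℤ A[X] :=
  ((coeffDerivation D).toLinearMap + LinearMap.mulLeft ℤ X) * LinearMap.mulLeft ℤ (C f)

/-- The operator `u ↦ f (D + X)(u)` on `A[X]`. -/
noncomputable def symbolStepSwap : Module.End ℤ A[X] :=
  LinearMap.mulLeft ℤ (C f) * ((coeffDerivation D).toLinearMap + LinearMap.mulLeft ℤ X)

theorem symbolStep_apply (u : A[X]) :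
    symbolStep D f u = coeffDerivation D (C f * u) + X * (C f * u) := rfl

theorem symbolStepSwap_apply (u : A[X]) :
    symbolStepSwap D f u = C f * (coeffDerivation D u + X * u) := rfl

theorem symbolStepSwap_pow_succ_one (n : ℕ) :
    (symbolStepSwap D f ^ (n + 1)) 1 = X * (C f * (symbolStep D f ^ n) 1) := by
  induction n with
  | zero =>
    rw [zero_add, pow_one, pow_zero, Module.End.one_apply, symbolStepSwap_apply,
      Derivation.map_one_eq_zero]
    ring
  | succ n ih =>
    rw [pow_succ', Module.End.mul_apply, ih, pow_succ' (symbolStep D f), Module.End.mul_apply,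
      symbolStepSwap_apply, symbolStep_apply, coeffDerivation_X_mul]
    ring

theorem coeff_zero_symbolStep_pow_one (n : ℕ) :
    ((symbolStep D f ^ n) 1).coeff 0 = (fun u : A => D (f * u))^[n] 1 := by
  induction n with
  | zero => simp
  | succ n ih =>
    rw [pow_succ', Module.End.mul_apply, symbolStep_apply, Function.iterate_succ_apply', ← ih]
    simp only [coeff_add, coeff_coeffDerivation, mul_coeff_zero, coeff_X_zero,
      zero_mul, add_zero, coeff_C_zero]

theorem coeff_symbolStep_pow_one_eq_zero {n k : ℕ} (h : n < k) :
    ((symbolStep D f ^ n) 1).coeff k = 0 := by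
  induction n generalizing k with
  | zero => simp [coeff_one, h.ne']
  | succ n ih =>
    obtain ⟨k, rfl⟩ := Nat.exists_eq_succ_of_ne_zero (Nat.ne_zero_of_lt h)
    rw [pow_succ', Module.End.mul_apply, symbolStep_apply, coeff_add, coeff_coeffDerivation,
      coeff_X_mul, coeff_C_mul, coeff_C_mul, ih (by omega), ih (by omega)]
    simp

theorem coeff_symbolStep_pow_one (n : ℕ) : ((symbolStep D f ^ n) 1).coeff n = f ^ n := by
  induction n with
  | zero => simp
  | succ n ih =>
    rw [pow_succ', Module.End.mul_apply, symbolStep_apply, coeff_add, coeff_coeffDerivation,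
      coeff_X_mul, coeff_C_mul, coeff_C_mul, ih,
      coeff_symbolStep_pow_one_eq_zero D f n.lt_succ_self, mul_zero, map_zero, zero_add, pow_succ']

theorem sum_iterate_coeff_coeffDerivation_add_X_mul (g : A[X]) (n : ℕ) :
    ∑ k ∈ Finset.range (n + 1), (-1) ^ k * D^[k] ((coeffDerivation D g + X * g).coeff k) =
      (-1) ^ n * D^[n + 1] (g.coeff n) := by
  induction n with
  | zero => simp
  | succ n ih =>
    rw [Finset.sum_range_succ, ih, coeff_add, coeff_X_mul, iterate_map_add,
      coeff_coeffDerivation, ← Function.iterate_succ_apply]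
    ring

theorem sum_iterate_coeff_symbolStep_pow_one {n : ℕ} (hn : n ≠ 0) :
    ∑ k ∈ Finset.range (n + 1), (-1) ^ k * D^[k] (((symbolStep D f ^ n) 1).coeff k) = 0 := by
  obtain ⟨m, rfl⟩ := Nat.exists_eq_succ_of_ne_zero hn
  rw [pow_succ', Module.End.mul_apply, symbolStep_apply,
    sum_iterate_coeff_coeffDerivation_add_X_mul, coeff_C_mul,
    coeff_symbolStep_pow_one_eq_zero D f m.lt_succ_self, mul_zero, iterate_map_zero, mul_zero]

theorem derivative_symbolStepSwap_pow_prime_one {p : ℕ} (hp : p.Prime) [CharP A p] :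
    ∃ a : A, derivative ((symbolStepSwap D f ^ p) 1) = C a := by
  set M := symbolStepSwap D f with hM
  let d : Module.End ℤ A[X] := (derivative (R := A)).restrictScalars ℤ
  have hzero : (p : Module.End ℤ A[X]) = 0 := by
    ext1 u
    rw [Module.End.natCast_apply, ← Nat.cast_smul_eq_nsmul A[X], CharP.cast_eq_zero, zero_smul,
      LinearMap.zero_apply]
  have hconst (n : ℕ) : ∃ a : A,
      ((LinearMap.mulLeft ℤ M - LinearMap.mulRight ℤ M) ^ (n + 1)) d =
        LinearMap.mulLeft ℤ (C a) := by
    induction n with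
    | zero =>
      refine ⟨-f, LinearMap.ext fun u => ?_⟩
      simp only [zero_add, pow_one, LinearMap.sub_apply, LinearMap.mulLeft_apply,
        LinearMap.mulRight_apply, Module.End.mul_apply, hM, symbolStepSwap_apply, d,
        LinearMap.restrictScalars_apply, derivative_C, derivative_add, derivative_mul,
        derivative_X, derivative_coeffDerivation, C_neg]
      ring
    | succ n ih =>
      obtain ⟨a, ha⟩ := ih
      refine ⟨f * D a, LinearMap.ext fun u => ?_⟩
      rw [pow_succ', Module.End.mul_apply, ha]
      simp only [LinearMap.sub_apply, LinearMap.mulLeft_apply, LinearMap.mulRight_apply,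
        Module.End.mul_apply, hM, symbolStepSwap_apply, Derivation.leibniz, coeffDerivation_C,
        smul_eq_mul, C_mul]
      ring
  obtain ⟨a, ha⟩ := hconst (p - 1)
  rw [Nat.sub_add_cancel hp.one_le, mulLeft_sub_mulRight_pow_prime_apply hp hzero] at ha
  refine ⟨-a, ?_⟩
  have h := LinearMap.congr_fun ha 1
  simp only [LinearMap.sub_apply, Module.End.mul_apply, LinearMap.mulLeft_apply, mul_one, d,
    LinearMap.restrictScalars_apply, derivative_one, map_zero, zero_sub] at h
  rw [C_neg, ← h, neg_neg]

theorem coeff_symbolStep_pow_pred_prime_one {p : ℕ} (hp : p.Prime) [CharP A p]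
    (hf : IsLeftRegular f) {k : ℕ} (hk : k ≠ 0) (hkp : k + 1 < p) :
    ((symbolStep D f ^ (p - 1)) 1).coeff k = 0 := by
  obtain ⟨a, ha⟩ := derivative_symbolStepSwap_pow_prime_one D f hp
  have h := congrArg (coeff · k) ha
  have : Fact p.Prime := ⟨hp⟩
  have hunit : IsUnit ((k + 1 : ℕ) : A) :=
    (CharP.isUnit_natCast_iff hp).2 (Nat.not_dvd_of_pos_of_lt k.succ_pos hkp)
  rw [← Nat.sub_add_cancel hp.one_le, symbolStepSwap_pow_succ_one] at h
  simp only [coeff_derivative, coeff_X_mul, coeff_C_mul, coeff_C, hk, if_false] at h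
  rw [← Nat.cast_succ, hunit.mul_left_eq_zero] at h
  exact hf (h.trans (mul_zero f).symm)

theorem iterate_derivation_mul_one_of_isLeftRegular {p : ℕ} (hp : p.Prime) [CharP A p]
    (hf : IsLeftRegular f) :
    (fun u : A => D (f * u))^[p - 1] 1 = -D^[p - 1] (f ^ (p - 1)) := by
  have : Fact p.Prime := ⟨hp⟩
  have h := sum_iterate_coeff_symbolStep_pow_one D f (Nat.sub_ne_zero_of_lt hp.one_lt)
  have hsign : (-1 : A) ^ (p - 1) = 1 := by
    have := neg_one_pow_char A p
    rw [← Nat.sub_add_cancel hp.one_le, pow_succ] at this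
    simpa using this
  rw [Finset.sum_range_succ, Finset.sum_eq_single_of_mem 0, coeff_symbolStep_pow_one, hsign,
    coeff_zero_symbolStep_pow_one] at h
  · simpa [eq_neg_iff_add_eq_zero] using h
  · simpa using hp.one_lt
  · intro k hk hk0
    rw [coeff_symbolStep_pow_pred_prime_one D f hp hf hk0 (by have := Finset.mem_range.1 hk; omega),
      iterate_map_zero, mul_zero]

end RegularCase

theorem word_eq_neg_iterated_deriv_of_power (p : ℕ) (hp : p.Prime)
    (A : Type*) [CommRing A] [CharP A p]
    (D : A → A) (hadd : ∀ a b : A, D (a + b) = D a + D b)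
    (hleib : ∀ a b : A, D (a * b) = a * D b + b * D a)
    (f : A) :
    (fun u : A => D (f * u))^[p - 1] 1 = - D^[p - 1] (f ^ (p - 1)) := by
  let δ : Derivation ℤ A A := Derivation.mk' (AddMonoidHom.mk' D hadd).toIntLinearMap hleib
  have hδ (g : A[X]) : (coeffDerivation δ g).coeff 0 = D (g.coeff 0) := rfl
  -- `X + C f` is regular in `A[X]` and specializes to `f` at `X = 0`.
  have h := congrArg (coeff · 0) <| iterate_derivation_mul_one_of_isLeftRegular
    (coeffDerivation δ) (X + C f) hp (monic_X_add_C f).isRegular.left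
  have hword : Function.Semiconj (coeff · 0)
      (fun u : A[X] => coeffDerivation δ ((X + C f) * u)) (fun u : A => D (f * u)) := fun u => by
    simp only [hδ, mul_coeff_zero, coeff_add, coeff_X_zero, coeff_C_zero, zero_add]
  have hiter : Function.Semiconj (coeff · 0) (coeffDerivation δ) D := hδ
  have hlhs := (hword.iterate_right (p - 1)).eq 1
  have hrhs := (hiter.iterate_right (p - 1)).eq ((X + C f) ^ (p - 1))
  have h' := hlhs.symm.trans (h.trans ((coeff_neg _ 0).trans (congrArg Neg.neg hrhs)))
  simpa [coeff_zero_eq_eval_zero] using h'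
end

section
/- Let p be a prime and F a field of characteristic p. For every f ∈ F[X], letting S_f : F[X] → F[X] be the map u ↦ ∂(f·u), one has the exact identity in F[X]: (S_f)^{p−1}(1) = −∂^{p−1}(f^{p−1}), i.e. the word ∂f∂f…∂f (with p−1 letters ∂ and p−1 letters f) equals minus the (p−1)-st derivative of f^{p−1}. -/
open Finset in
/-- Leibniz rule for the iterates of a derivation. -/
theorem Derivation.iterate_apply_mul {R A : Type*} [CommRing R] [CommRing A] [Algebra R A]
    (D : Derivation R A A) (n : ℕ) (a b : A) :
    D^[n] (a * b) = ∑ i ∈ range (n + 1), (n.choose i : A) * (D^[n - i] a * D^[i] b) := by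
  have key : D^[n] (b * a) =
      ∑ ij ∈ antidiagonal n, n.choose ij.1 • (D^[ij.1] b * D^[ij.2] a) := by
    induction n with
    | zero => simp
    | succ n ih =>
      rw [sum_antidiagonal_choose_succ_nsmul (M := A) (fun i j => D^[i] b * D^[j] a) n]
      simp only [Function.iterate_succ_apply', ih, map_sum, map_nsmul, Derivation.leibniz,
        smul_add, sum_add_distrib, smul_eq_mul]
      refine congrArg₂ _ rfl (sum_congr rfl fun ij hij => ?_)
      rw [n.choose_symm_of_eq_add (mem_antidiagonal.1 hij).symm, mul_comm]
  rw [mul_comm, key,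
    Nat.sum_antidiagonal_eq_sum_range_succ (fun i j => n.choose i • (D^[i] b * D^[j] a)) n]
  exact sum_congr rfl fun i _ => by rw [nsmul_eq_mul, mul_comm (D^[i] b)]

/-- In characteristic `p`, the `p`-th iterate of a derivation satisfies the Leibniz rule. -/
theorem Derivation.iterate_char_apply_mul {R A : Type*} [CommRing R] [CommRing A] [Algebra R A]
    (p : ℕ) (hp : p.Prime) [CharP A p] (D : Derivation R A A) (a b : A) :
    D^[p] (a * b) = a * D^[p] b + b * D^[p] a := by
  rw [D.iterate_apply_mul, Finset.sum_range_succ, Finset.sum_eq_single_of_mem 0]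
  · simp; ring
  · simpa using hp.pos
  · intro i hi hi0
    rw [(CharP.cast_eq_zero_iff A p _).2 (hp.dvd_choose_self hi0 (Finset.mem_range.1 hi)), zero_mul]

/-- The iterates `1, D, …, D ^ m` of a derivation `D` of a domain that is nonzero at some `x` are
linearly independent as long as `1, …, m` are nonzero in the domain. -/
theorem Derivation.coeff_eq_zero_of_sum_iterate_eq_zero {R A : Type*} [CommRing R] [CommRing A]
    [IsDomain A] [Algebra R A] (D : Derivation R A A) {x : A} (hx : D x ≠ 0) (m : ℕ)
    (hm : ∀ k < m, ((k + 1 : ℕ) : A) ≠ 0) (e : ℕ → A)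
    (h : ∀ u, ∑ i ∈ Finset.range (m + 1), e i * D^[i] u = 0) :
    ∀ i ≤ m, e i = 0 := by
  induction m generalizing e with
  | zero =>
    intro i hi
    obtain rfl : i = 0 := by omega
    simpa using h 1
  | succ m ih =>
    have hm' : ∀ k < m, ((k + 1 : ℕ) : A) ≠ 0 := fun k hk => hm k (by omega)
    let c : ℕ → A := fun j =>
      ∑ i ∈ Finset.range (m + 2), e i * ((i.choose j : A) * D^[i - j] x) - x * e j
    have hc : ∀ u, ∑ j ∈ Finset.range (m + 1), c j * D^[j] u = 0 := by
      intro u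
      have hlast : c (m + 1) = 0 := by
        have h0 : ∑ i ∈ Finset.range (m + 1),
            e i * ((i.choose (m + 1) : A) * D^[i - (m + 1)] x) = 0 :=
          Finset.sum_eq_zero fun i hi => by
            rw [Nat.choose_eq_zero_of_lt (Finset.mem_range.1 hi)]; simp
        simp only [c, Finset.sum_range_succ _ (m + 1), h0]
        simp [mul_comm]
      have hext : ∀ i ∈ Finset.range (m + 2), D^[i] (x * u) =
          ∑ j ∈ Finset.range (m + 2), (i.choose j : A) * (D^[i - j] x * D^[j] u) := by
        intro i hi
        rw [D.iterate_apply_mul]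
        refine Finset.sum_subset
          (Finset.range_subset_range.2 (by have := Finset.mem_range.1 hi; omega)) fun j _ hj => ?_
        rw [Nat.choose_eq_zero_of_lt (by simpa using hj)]; simp
      have hsum : ∑ j ∈ Finset.range (m + 2), c j * D^[j] u =
          ∑ i ∈ Finset.range (m + 2), e i * D^[i] (x * u)
            - x * ∑ i ∈ Finset.range (m + 2), e i * D^[i] u := by
        rw [Finset.sum_congr rfl fun i hi => congrArg (e i * ·) (hext i hi)]
        simp only [c, sub_mul, Finset.sum_sub_distrib, Finset.sum_mul, Finset.mul_sum]
        rw [Finset.sum_comm]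
        congr 1
        · exact Finset.sum_congr rfl fun i _ => Finset.sum_congr rfl fun j _ => by ring
        · exact Finset.sum_congr rfl fun i _ => by ring
      rw [h, h, Finset.sum_range_succ, hlast] at hsum
      simpa using hsum
    have hcm : c m = ((m + 1 : ℕ) : A) * (e (m + 1) * D x) := by
      have h0 : ∑ i ∈ Finset.range m, e i * ((i.choose m : A) * D^[i - m] x) = 0 :=
        Finset.sum_eq_zero fun i hi => by
          rw [Nat.choose_eq_zero_of_lt (Finset.mem_range.1 hi)]; simp
      simp only [c, Finset.sum_range_succ _ (m + 1), Finset.sum_range_succ _ m, h0]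
      simp
      ring
    have htop : e (m + 1) = 0 := by
      have := ih hm' c hc m le_rfl
      rw [hcm] at this
      simpa only [mul_eq_zero, hm m (by omega), hx, false_or, or_false] using this
    intro i hi
    rcases Nat.lt_or_eq_of_le hi with hi | rfl
    · refine ih hm' e (fun u => ?_) i (by omega)
      simpa [Finset.sum_range_succ _ (m + 1), htop] using h u
    · exact htop

namespace Polynomial

/-- In characteristic `p`, the `p`-th iterated derivative of a polynomial vanishes. -/
theorem iterate_derivative_char_eq_zero {R : Type*} [CommRing R] (p : ℕ) (hp : p.Prime)
    [CharP R p] (u : R[X]) : derivative^[p] u = 0 := by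
  rw [← factorial_smul_hasseDeriv, LinearMap.smul_apply, nsmul_eq_mul,
    (CharP.cast_eq_zero_iff R[X] p _).2 (hp.dvd_factorial.2 le_rfl), zero_mul]

/-- The operator `f ^ (n + 1) * ∂ ^ (n + 1)` is a monic combination of the iterates of `f * ∂`,
whose coefficient at `f * ∂` itself is `f ^ (n + 1) * ∂ ^ n (1 / f)`; in characteristic `p` the
latter is described by the `n`-th derivative of `f ^ (p - 1)`. -/
theorem exists_pow_mul_iterate_derivative_eq_sum {R : Type*} [CommRing R] (p : ℕ)
    [CharP R p] (f : R[X]) (n : ℕ) (hn : n < p) :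
    ∃ b : ℕ → R[X], b n = 1 ∧ (∀ i, n < i → b i = 0) ∧
      b 0 * f ^ (p - 1 - n) = derivative^[n] (f ^ (p - 1)) ∧
      ∀ u, f ^ (n + 1) * derivative^[n + 1] u =
        ∑ i ∈ Finset.range (n + 1), b i * (mkDerivation R f)^[i + 1] u := by
  have hD : ∀ v, mkDerivation R f v = f * derivative v := fun v => by
    rw [mkDerivation_apply, smul_eq_mul, mul_comm]
  induction n with
  | zero =>
    refine ⟨fun i => if i = 0 then 1 else 0, by simp, fun i hi => by simp; omega, by simp, ?_⟩
    simp [hD]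
  | succ n ih =>
    obtain ⟨b, hb1, hb0, hbf, hb⟩ := ih (by omega)
    let q : ℕ → R[X] := fun i => f * derivative (b i) - (n + 1 : ℕ) * derivative f * b i
    refine ⟨fun i => q i + if i = 0 then 0 else b (i - 1), ?_, ?_, ?_, ?_⟩
    · simp [q, hb0 (n + 1) (by omega), hb1]
    · intro i hi
      simp [q, hb0 i (by omega), hb0 (i - 1) (by omega)]
    · obtain ⟨k, rfl⟩ : ∃ k, p = n + 2 + k := ⟨p - (n + 2), by omega⟩
      have hk : n + 2 + k - 1 - n = k + 1 := by omega
      have hk' : n + 2 + k - 1 - (n + 1) = k := by omega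
      have hchar : ((n + 2 + k : ℕ) : R[X]) = 0 := CharP.cast_eq_zero _ _
      rw [Function.iterate_succ_apply', ← hbf, hk, hk']
      simp only [q, derivative_mul, derivative_pow_succ, if_true, add_zero]
      push_cast at hchar ⊢
      simp only [map_add, map_natCast, map_one]
      linear_combination (-derivative f * b 0 * f ^ k) * hchar
    · intro u
      have hstep : f ^ (n + 1 + 1) * derivative^[n + 1 + 1] u =
          f * derivative (f ^ (n + 1) * derivative^[n + 1] u)
            - (n + 1 : ℕ) * derivative f * (f ^ (n + 1) * derivative^[n + 1] u) := by
        rw [Function.iterate_succ_apply' _ (n + 1), derivative_mul, derivative_pow_succ]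
        push_cast
        simp only [map_add, map_natCast, map_one]
        ring
      have hq : ∑ i ∈ Finset.range (n + 1), q i * (mkDerivation R f)^[i + 1] u =
          ∑ i ∈ Finset.range (n + 2), q i * (mkDerivation R f)^[i + 1] u := by
        simp [Finset.sum_range_succ _ (n + 1), q, hb0 (n + 1) (by omega)]
      have hshift : ∑ i ∈ Finset.range (n + 2),
          (if i = 0 then 0 else b (i - 1)) * (mkDerivation R f)^[i + 1] u =
          ∑ i ∈ Finset.range (n + 1), b i * (mkDerivation R f)^[i + 2] u := by
        simp [Finset.sum_range_succ' _ (n + 1)]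
      simp only [add_mul, Finset.sum_add_distrib]
      rw [hstep, hb, ← hq, hshift, derivative_sum, Finset.mul_sum, Finset.mul_sum,
        ← Finset.sum_sub_distrib, ← Finset.sum_add_distrib]
      refine Finset.sum_congr rfl fun i _ => ?_
      rw [Function.iterate_succ_apply' _ (i + 1), hD, derivative_mul]
      ring

/-- The word `∂f∂f…∂f` is a multiplier relating `f * ∂` and its `p`-th iterate. -/
theorem iterate_char_mkDerivation {R : Type*} [CommRing R] (p : ℕ) (hp : p.Prime) [CharP R p]
    (f u : R[X]) :
    (mkDerivation R f)^[p] u =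
      (fun v : R[X] => derivative (f * v))^[p - 1] 1 * mkDerivation R f u := by
  have hD : ∀ v, mkDerivation R f v = f * derivative v := fun v => by
    rw [mkDerivation_apply, smul_eq_mul, mul_comm]
  have hX : ∀ n, (mkDerivation R f)^[n + 1] X =
      f * (fun v : R[X] => derivative (f * v))^[n] 1 := by
    intro n
    induction n with
    | zero => simp
    | succ n ih => rw [Function.iterate_succ_apply', ih, hD, Function.iterate_succ_apply']
  let E : Derivation R R[X] R[X] :=
    Derivation.mk' ((mkDerivation R f : R[X] →ₗ[R] R[X]) ^ p) fun a b => by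
      simpa [Module.End.pow_apply] using
        (mkDerivation R f).iterate_char_apply_mul p hp a b
  have hE : E = (fun v : R[X] => derivative (f * v))^[p - 1] 1 • mkDerivation R f := by
    refine derivation_ext ?_
    have := hX (p - 1)
    rw [Nat.sub_add_cancel hp.one_le] at this
    simpa [E, Module.End.pow_apply, mul_comm f] using this
  simpa [E, Module.End.pow_apply] using DFunLike.congr_fun hE u

end Polynomial

theorem word_eq_neg_iterated_deriv_of_power_poly (p : ℕ) (hp : p.Prime)
    (F : Type*) [Field F] [CharP F p] (f : Polynomial F) :
    (fun u : Polynomial F => Polynomial.derivative (f * u))^[p - 1] 1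
      = - (Polynomial.derivative (R := F))^[p - 1] (f ^ (p - 1)) := by
  obtain ⟨m, rfl⟩ : ∃ m, p = m + 2 := ⟨p - 2, by have := hp.two_le; omega⟩
  rcases eq_or_ne f 0 with rfl | hf
  · rw [show m + 2 - 1 = m + 1 from rfl, Function.iterate_succ_apply']
    simp
  obtain ⟨b, hb1, -, hbf, hb⟩ :=
    Polynomial.exists_pow_mul_iterate_derivative_eq_sum (m + 2) f (m + 1) (by omega)
  set W := (fun u : Polynomial F => Polynomial.derivative (f * u))^[m + 2 - 1] 1 with hW
  let D := Polynomial.mkDerivation F f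
  let e : ℕ → Polynomial F := fun i => if i = 0 then 0 else if i = 1 then b 0 + W else b (i - 1)
  have he : ∀ u, ∑ i ∈ Finset.range (m + 1 + 1), e i * D^[i] u = 0 := by
    intro u
    have h := hb u
    rw [Polynomial.iterate_derivative_char_eq_zero (m + 2) hp, mul_zero,
      Finset.sum_range_succ, hb1, Polynomial.iterate_char_mkDerivation (m + 2) hp,
      ← hW, Finset.sum_range_succ'] at h
    rw [Finset.sum_range_succ', Finset.sum_range_succ']
    simp only [e, D, Function.iterate_succ_apply, Function.iterate_zero_apply] at h ⊢
    simp at h ⊢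
    linear_combination -h
  have hcast : ∀ k < m + 1, ((k + 1 : ℕ) : Polynomial F) ≠ 0 := fun k hk h0 => by
    have := Nat.le_of_dvd (by omega) ((CharP.cast_eq_zero_iff (Polynomial F) (m + 2) _).1 h0)
    omega
  have h1 : b 0 + W = 0 := by
    simpa [e] using D.coeff_eq_zero_of_sum_iterate_eq_zero (x := Polynomial.X)
      (by simpa [D] using hf) (m + 1) hcast e he 1 (by omega)
  have hb0 : b 0 = Polynomial.derivative^[m + 2 - 1] (f ^ (m + 2 - 1)) := by simpa using hbf
  rw [← hb0]
  exact eq_neg_of_add_eq_zero_right h1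
end

section
/- Let p be a prime. In the multivariate polynomial ring (ZMod p)[t_1, …, t_{p−1}] (i.e. MvPolynomial (Fin (p−1)) (ZMod p)), the following identity holds: ∑_{σ ∈ S_{p−1}} t_{σ(1)}·(t_{σ(1)}+t_{σ(2)})·…·(t_{σ(1)}+…+t_{σ(p−1)}) = (t_1 + … + t_{p−1})^{p−1}, where the sum is over all permutations σ of {1, …, p−1} and the σ-term is the product over k = 1, …, p−1 of the partial sums t_{σ(1)} + … + t_{σ(k)}. -/
open Finset

section ChainSum

variable {ι κ R : Type*} [DecidableEq ι] [DecidableEq κ] [CommRing R]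

/-- The sum, over all orderings `i₁, …, iₘ` of `S`, of `∏ₖ (x + t i₁ + ⋯ + t iₖ)`, defined by
recursion on the last element of the ordering. -/
noncomputable def chainSum (t : ι → R) (x : R) (S : Finset ι) : R :=
  if S = ∅ then 1 else (x + ∑ i ∈ S, t i) * ∑ i : S, chainSum t x (S.erase i)
termination_by S.card
decreasing_by exact card_erase_lt_of_mem i.2

/-- The sum, over all orderings `i₁, …, iₘ` of `S`, of `∏ₖ (x + t i₁ + ⋯ + t iₖ₋₁)`. -/
noncomputable def lowerChainSum (t : ι → R) (x : R) (S : Finset ι) : R :=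
  if S = ∅ then 1 else x * ∑ i ∈ S, chainSum t x (S.erase i)

@[simp]
lemma chainSum_empty (t : ι → R) (x : R) : chainSum t x ∅ = 1 := by
  rw [chainSum, if_pos rfl]

lemma chainSum_of_nonempty (t : ι → R) (x : R) {S : Finset ι} (hS : S.Nonempty) :
    chainSum t x S = (x + ∑ i ∈ S, t i) * ∑ i ∈ S, chainSum t x (S.erase i) := by
  rw [chainSum, if_neg hS.ne_empty, ← sum_coe_sort S fun i => chainSum t x (S.erase i)]

@[simp]
lemma lowerChainSum_empty (t : ι → R) (x : R) : lowerChainSum t x ∅ = 1 := by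
  rw [lowerChainSum, if_pos rfl]

lemma lowerChainSum_of_nonempty (t : ι → R) (x : R) {S : Finset ι} (hS : S.Nonempty) :
    lowerChainSum t x S = x * ∑ i ∈ S, chainSum t x (S.erase i) := by
  rw [lowerChainSum, if_neg hS.ne_empty]

lemma add_sum_mul_lowerChainSum (t : ι → R) (x : R) (S : Finset ι) :
    (x + ∑ i ∈ S, t i) * lowerChainSum t x S = x * chainSum t x S := by
  rcases S.eq_empty_or_nonempty with rfl | hS
  · simp
  · rw [lowerChainSum_of_nonempty t x hS, chainSum_of_nonempty t x hS]
    ring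

lemma lowerChainSum_eq_sum_erase (t : ι → R) (x : R) {S : Finset ι} (hS : S.Nonempty) :
    lowerChainSum t x S =
      ∑ i ∈ S, (x + ∑ j ∈ S.erase i, t j) * lowerChainSum t x (S.erase i) := by
  simp_rw [add_sum_mul_lowerChainSum, ← mul_sum]
  exact lowerChainSum_of_nonempty t x hS

lemma chainSum_map (e : κ ↪ ι) (t : ι → R) (x : R) (S : Finset κ) :
    chainSum t x (S.map e) = chainSum (t ∘ e) x S := by
  induction S using Finset.strongInduction with
  | H S ih =>
    rcases S.eq_empty_or_nonempty with rfl | hS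
    · simp
    · rw [chainSum_of_nonempty _ _ hS, chainSum_of_nonempty _ _ (hS.map), sum_map, sum_map]
      congr 1
      refine sum_congr rfl fun i hi => ?_
      rw [← map_erase, ih _ (erase_ssubset hi)]

lemma chainSum_zero_left (x : R) (S : Finset ι) :
    chainSum (fun _ => 0) x S = (S.card.factorial : R) * x ^ S.card := by
  induction S using Finset.strongInduction with
  | H S ih =>
    rcases S.eq_empty_or_nonempty with rfl | hS
    · simp
    · rw [chainSum_of_nonempty _ _ hS, sum_congr rfl fun i hi => (ih _ (erase_ssubset hi)).trans (by
        rw [card_erase_of_mem hi])]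
      obtain ⟨m, hm⟩ := Nat.exists_eq_succ_of_ne_zero hS.card_ne_zero
      simp only [hm, sum_const, nsmul_eq_mul, Nat.succ_eq_add_one,
        Nat.add_sub_cancel, Nat.factorial_succ]
      push_cast
      ring

lemma sum_powerset_erase {M : Type*} [AddCommMonoid M] (S : Finset ι) (f : ι → Finset ι → M) :
    ∑ i ∈ S, ∑ A ∈ (S.erase i).powerset, f i A = ∑ B ∈ S.powerset, ∑ i ∈ B, f i (B.erase i) := by
  have h : ∀ i ∈ S, ∑ A ∈ (S.erase i).powerset, f i A =
      ∑ B ∈ S.powerset with i ∈ B, f i (B.erase i) := by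
    intro i hi
    refine sum_nbij' (insert i) (fun B => B.erase i) ?_ ?_ ?_ ?_ ?_
    · intro A hA
      simp only [mem_powerset, mem_filter, mem_insert_self, and_true] at hA ⊢
      exact insert_subset hi (hA.trans (erase_subset _ _))
    · intro B hB
      simp only [mem_powerset, mem_filter] at hB ⊢
      exact erase_subset_erase _ hB.1
    · intro A hA
      exact erase_insert fun h => notMem_erase i S (mem_powerset.1 hA h)
    · intro B hB
      exact insert_erase (mem_filter.1 hB).2
    · intro A hA
      rw [erase_insert fun h => notMem_erase i S (mem_powerset.1 hA h)]
  rw [sum_congr rfl h]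
  refine sum_comm' fun i B => ?_
  simp only [mem_filter, mem_powerset]
  exact ⟨fun h => ⟨h.2.2, h.2.1⟩, fun h => ⟨h.2 h.1, h.2, h.1⟩⟩

lemma chainSum_add (t : ι → R) (x y : R) (S : Finset ι) :
    chainSum t (x + y) S =
      ∑ A ∈ S.powerset,
        (S.card.choose A.card : R) * (chainSum t x A * lowerChainSum t y (S \ A)) := by
  induction S using Finset.strongInduction with
  | H S ih =>
    rcases S.eq_empty_or_nonempty with rfl | hS
    · simp
    obtain ⟨m, hm⟩ := Nat.exists_eq_succ_of_ne_zero hS.card_ne_zero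
    have split : chainSum t (x + y) S =
        ∑ i ∈ S, ∑ A ∈ (S.erase i).powerset,
          (m.choose A.card : R) * ((x + ∑ j ∈ insert i A, t j) * chainSum t x A *
            lowerChainSum t y (S \ insert i A)) +
        ∑ i ∈ S, ∑ A ∈ (S.erase i).powerset,
          (m.choose A.card : R) * (chainSum t x A *
            ((y + ∑ j ∈ (S \ A).erase i, t j) * lowerChainSum t y ((S \ A).erase i))) := by
      rw [chainSum_of_nonempty _ _ hS, mul_sum, ← sum_add_distrib]
      refine sum_congr rfl fun i hi => ?_
      rw [ih _ (erase_ssubset hi), mul_sum, ← sum_add_distrib, card_erase_of_mem hi, hm]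
      refine sum_congr rfl fun A hA => ?_
      have hAS : insert i A ⊆ S :=
        insert_subset hi ((mem_powerset.1 hA).trans (erase_subset _ _))
      have h₁ : S.erase i \ A = S \ insert i A := by grind
      have h₂ : (S \ A).erase i = S \ insert i A := by grind
      rw [h₁, h₂, ← sum_sdiff hAS, Nat.succ_eq_add_one, Nat.add_sub_cancel]
      ring
    have swap : ∀ f : ι → Finset ι → R, ∑ i ∈ S, ∑ A ∈ (S.erase i).powerset, f i A =
        ∑ A ∈ S.powerset, ∑ i ∈ S \ A, f i A := by
      intro f
      refine sum_comm' fun i A => ?_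
      simp only [mem_powerset, mem_sdiff, subset_erase]
      tauto
    rw [split, sum_powerset_erase, swap, ← sum_add_distrib]
    refine sum_congr rfl fun A hA => ?_
    rw [mem_powerset] at hA
    have lower : ∑ i ∈ A, (m.choose (A.erase i).card : R) *
        ((x + ∑ j ∈ insert i (A.erase i), t j) * chainSum t x (A.erase i) *
          lowerChainSum t y (S \ insert i (A.erase i))) =
        (m.choose (A.card - 1) : R) * (((x + ∑ j ∈ A, t j) * ∑ i ∈ A, chainSum t x (A.erase i)) *
          lowerChainSum t y (S \ A)) := by
      rw [mul_sum, sum_mul, mul_sum]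
      refine sum_congr rfl fun i hi => ?_
      rw [insert_erase hi, card_erase_of_mem hi]
    rw [lower, ← mul_sum, ← mul_sum, hm]
    rcases A.eq_empty_or_nonempty with rfl | hA₀
    · rw [sdiff_empty, ← lowerChainSum_eq_sum_erase t y hS]
      simp
    rw [← chainSum_of_nonempty t x hA₀]
    obtain ⟨a, ha⟩ := Nat.exists_eq_succ_of_ne_zero hA₀.card_ne_zero
    rcases (S \ A).eq_empty_or_nonempty with hSA | hSA
    · have : A = S := hA.antisymm (sdiff_eq_empty_iff_subset.1 hSA)
      subst this
      simp [hm]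
    · rw [← lowerChainSum_eq_sum_erase t y hSA, ha, Nat.succ_eq_add_one, Nat.succ_eq_add_one,
        Nat.choose_succ_succ]
      push_cast
      ring

lemma sum_chainSum_erase_eq [IsDomain R] {p : ℕ} (hp : p.Prime) [CharP R p] (t : ι → R) (y : R)
    {S : Finset ι} (hS : S.card = p) (hT : ∑ i ∈ S, t i ≠ 0) :
    ∑ i ∈ S, chainSum t y (S.erase i) = ∑ i ∈ S, chainSum t 0 (S.erase i) := by
  have hne : S.Nonempty := card_pos.1 (hS ▸ hp.pos)
  have key : chainSum t (0 + y) S = lowerChainSum t y S + chainSum t 0 S := by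
    rw [chainSum_add, ← sum_subset (s₁ := {∅, S}), sum_pair hne.ne_empty.symm]
    · simp
    · intro A
      simp only [mem_insert, mem_singleton, mem_powerset]
      rintro (rfl | rfl) <;> simp
    · intro A hA hA'
      simp only [mem_insert, mem_singleton, not_or, mem_powerset] at hA hA'
      have hlt : A.card < p := hS ▸ card_lt_card (hA.ssubset_of_ne hA'.2)
      have hdvd : p ∣ S.card.choose A.card := by
        rw [hS]
        exact hp.dvd_choose_self (card_ne_zero.2 (nonempty_iff_ne_empty.2 hA'.1)) hlt
      rw [(CharP.cast_eq_zero_iff R p _).2 hdvd, zero_mul]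
  rw [zero_add, lowerChainSum_of_nonempty t y hne, chainSum_of_nonempty t y hne,
    chainSum_of_nonempty t 0 hne] at key
  apply mul_left_cancel₀ hT
  linear_combination key

lemma sum_perm_prod_sum_Ici (m : ℕ) (t : Fin m → R) :
    ∑ σ : Equiv.Perm (Fin m), ∏ k, ∑ i ∈ Ici k, t (σ i) = chainSum t 0 univ := by
  induction m with
  | zero => simp [univ_eq_empty]
  | succ m ih =>
    rw [← Equiv.Perm.decomposeFin.symm.sum_comp, Fintype.sum_prod_type,
      chainSum_of_nonempty _ _ univ_nonempty, mul_sum]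
    refine sum_congr rfl fun q _ => ?_
    let e : Fin m ↪ Fin (m + 1) := (Fin.succEmb m).trans (Equiv.swap 0 q).toEmbedding
    have he : univ.erase q = univ.map e := by
      refine (eq_of_subset_of_card_le ?_ ?_).symm
      · intro i hi
        obtain ⟨j, -, rfl⟩ := mem_map.1 hi
        refine mem_erase.2 ⟨fun h => ?_, mem_univ _⟩
        have : Equiv.swap 0 q j.succ = Equiv.swap 0 q 0 := by simpa [e] using h
        exact Fin.succ_ne_zero j ((Equiv.swap 0 q).injective this)
      · simp
    rw [he, chainSum_map, ← ih, mul_sum]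
    refine sum_congr rfl fun σ _ => ?_
    rw [Fin.prod_univ_succ]
    congr 1
    · rw [zero_add, ← Equiv.sum_comp (Equiv.Perm.decomposeFin.symm (q, σ)) t]
      congr 1
      ext i
      simp
    · refine prod_congr rfl fun k _ => ?_
      rw [← Fin.map_succEmb_Ici, sum_map]
      simp [e]

end ChainSum

lemma chainSum_indicator_sub {p n : ℕ} (hp : p.Prime) (hn : n + 1 = p) {R : Type*} [CommRing R]
    [IsDomain R] [CharP R p] (X : Fin n → R)
    (hX : ∀ V : Finset (Fin n), V.Nonempty → ∑ i ∈ V, X i ≠ 0) (y : R) (V : Finset (Fin n)) :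
    chainSum (fun i => if i ∈ V then X i else 0) y univ -
      chainSum (fun i => if i ∈ V then X i else 0) 0 univ + y ^ n = 0 := by
  induction V using Finset.strongInduction with
  | H V ih =>
    rcases V.eq_empty_or_nonempty with rfl | hV
    · have hn₀ : n ≠ 0 := by
        rintro rfl
        exact hp.one_lt.ne hn
      have wilson : (n.factorial : R) = -1 := by
        have := Fact.mk hp
        have h := congrArg (ZMod.castHom (dvd_refl p) R) (ZMod.wilsons_lemma p)
        have hn' : p - 1 = n := by omega
        simpa [hn'] using h
      simp [chainSum_zero_left, wilson, hn₀]
    set t : Finset (Fin n) → Fin n → R := fun V i => if i ∈ V then X i else 0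
    set H : Finset (Fin n) → R := fun V => chainSum (t V) y univ - chainSum (t V) 0 univ + y ^ n
    change H V = 0
    let u : Option (Fin n) → R := fun o => o.elim 0 (t V)
    have hu : ∑ o, u o ≠ 0 := by
      simpa [u, t, Fintype.sum_option, ← sum_filter] using hX V hV
    have hnone : ∀ x, chainSum u x (univ.erase none) = chainSum (t V) x univ := by
      intro x
      have : univ.erase (none : Option (Fin n)) = univ.map Function.Embedding.some := by
        ext o
        cases o <;> simp
      rw [this, chainSum_map]
      rfl
    have hsome : ∀ x i, chainSum u x (univ.erase (some i)) = chainSum (t (V.erase i)) x univ := by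
      intro x i
      let e : Fin n ↪ Option (Fin n) :=
        Function.Embedding.some.trans (Equiv.swap none (some i)).toEmbedding
      have he : univ.erase (some i) = univ.map e := by
        refine (eq_of_subset_of_card_le ?_ ?_).symm
        · intro o ho
          obtain ⟨j, -, rfl⟩ := mem_map.1 ho
          refine mem_erase.2 ⟨fun h => ?_, mem_univ _⟩
          have : Equiv.swap none (some i) (some j) = Equiv.swap none (some i) none := by
            simpa [e] using h
          simpa using (Equiv.swap none (some i)).injective this
        · simp
      rw [he, chainSum_map]
      congr 1
      ext j
      by_cases hj : j = i
      · simp [e, u, t, hj]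
      · have : Equiv.swap none (some i) (some j) = some j :=
          Equiv.swap_apply_of_ne_of_ne (by simp) (by simpa using hj)
        simp [e, u, t, this, hj]
    have hcard : (univ : Finset (Option (Fin n))).card = p := by simp [hn]
    have hp₀ : (n : R) + 1 = 0 := by
      have := CharP.cast_eq_zero R p
      rw [← hn] at this
      exact_mod_cast this
    have key := sum_chainSum_erase_eq hp u y hcard hu
    simp only [Fintype.sum_option, hnone, hsome] at key
    have hsum : H V + ∑ i, H (V.erase i) = 0 := by
      simp only [H, sum_add_distrib, sum_sub_distrib, sum_const, card_univ, Fintype.card_fin,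
        nsmul_eq_mul]
      linear_combination key + y ^ n * hp₀
    have hcompl : ∑ i, H (V.erase i) = (Vᶜ.card : R) * H V := by
      rw [← sum_add_sum_compl V, sum_eq_zero fun i hi => ih _ (erase_ssubset hi), zero_add,
        sum_congr rfl fun i hi => by rw [erase_eq_of_notMem (mem_compl.1 hi)], sum_const,
        nsmul_eq_mul]
    have hne : ((Vᶜ.card + 1 : ℕ) : R) ≠ 0 := by
      rw [Ne, CharP.cast_eq_zero_iff R p]
      refine Nat.not_dvd_of_pos_of_lt (Nat.succ_pos _) ?_
      have h₁ := card_add_card_compl V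
      have h₂ := hV.card_pos
      rw [Fintype.card_fin] at h₁
      omega
    refine (mul_eq_zero.1 ?_).resolve_left hne
    push_cast
    linear_combination hsum - hcompl

lemma MvPolynomial.sum_X_ne_zero {σ R : Type*} [CommSemiring R] [Nontrivial R]
    {V : Finset σ} (hV : V.Nonempty) : ∑ i ∈ V, (X i : MvPolynomial σ R) ≠ 0 := by
  classical
  obtain ⟨j, hj⟩ := hV
  intro h
  have := congrArg (MvPolynomial.eval fun i => if i = j then (1 : R) else 0) h
  simp [hj] at this

theorem sum_perm_partial_sums_eq_pow (p : ℕ) (hp : p.Prime) :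
    ∑ σ : Equiv.Perm (Fin (p - 1)),
        ∏ k : Fin (p - 1), (∑ i ∈ Finset.Iic k, MvPolynomial.X (σ i) :
          MvPolynomial (Fin (p - 1)) (ZMod p))
      = (∑ i : Fin (p - 1), MvPolynomial.X i) ^ (p - 1) := by
  have := Fact.mk hp
  have hn : p - 1 + 1 = p := Nat.sub_add_cancel hp.one_le
  have hpos : (univ : Finset (Fin (p - 1))).Nonempty := by
    rw [← card_pos, card_univ, Fintype.card_fin]
    exact Nat.sub_pos_of_lt hp.one_lt
  have hrev : ∑ σ : Equiv.Perm (Fin (p - 1)), ∏ k : Fin (p - 1),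
        (∑ i ∈ Finset.Iic k, MvPolynomial.X (σ i) : MvPolynomial (Fin (p - 1)) (ZMod p)) =
      ∑ σ : Equiv.Perm (Fin (p - 1)), ∏ k : Fin (p - 1), ∑ i ∈ Ici k, MvPolynomial.X (σ i) := by
    rw [← Equiv.sum_comp (Equiv.mulRight Fin.revPerm)]
    refine sum_congr rfl fun σ _ => ?_
    rw [← Equiv.prod_comp Fin.revPerm]
    refine prod_congr rfl fun k _ => ?_
    refine sum_nbij' Fin.rev Fin.rev ?_ ?_ ?_ ?_ ?_ <;> simp [Fin.le_rev_iff]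
  rw [hrev, sum_perm_prod_sum_Ici _ fun i => (MvPolynomial.X i : MvPolynomial _ (ZMod p))]
  have key := chainSum_indicator_sub hp hn
    (fun i => (MvPolynomial.X i : MvPolynomial (Fin (p - 1)) (ZMod p)))
    (fun V hV => MvPolynomial.sum_X_ne_zero hV) (-∑ i, MvPolynomial.X i) univ
  simp only [mem_univ, if_true] at key
  have hsign : (-1 : MvPolynomial (Fin (p - 1)) (ZMod p)) ^ (p - 1) = 1 := by
    have h := ZMod.pow_card_sub_one_eq_one (p := p) (a := -1) (by simp)
    simpa using congrArg (MvPolynomial.C (σ := Fin (p - 1))) h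
  rw [chainSum_of_nonempty _ _ hpos, neg_add_cancel, zero_mul, zero_sub, neg_pow, hsign,
    one_mul] at key
  linear_combination -key
end

section
/- Let p be a prime, A a commutative ring of characteristic p, D : A → A a derivation, and f_1, …, f_{p−1} ∈ A. For a permutation σ of {1, …, p−1}, define b_1^σ := D(f_{σ(1)}) and b_{k+1}^σ := D(f_{σ(k+1)}·b_k^σ) for 1 ≤ k ≤ p−2, so that b_{p−1}^σ is the word ∂f_{σ(p−1)}∂f_{σ(p−2)}…∂f_{σ(1)}. Then ∑_{σ ∈ S_{p−1}} b_{p−1}^σ = D^{p−1}(f_1·f_2·…·f_{p−1}), where D^{p−1} is the (p−1)-fold iterate of D. -/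
section OrderedSum

variable {ι R : Type*} [DecidableEq ι] [CommRing R]

/-- The sum over all orderings `s₁, …, sₘ` of `U` of the products
`∏ i < m, (b + a s₁ + ⋯ + a sᵢ)`, defined by recursion on the last element. -/
def orderedSum (a : ι → R) (b : R) (U : Finset ι) : R :=
  if U = ∅ then 1
  else ∑ s ∈ U.attach, (b + ∑ i ∈ U.erase s, a i) * orderedSum a b (U.erase s)
termination_by U.card
decreasing_by exact Finset.card_erase_lt_of_mem s.2

/-- The variant of `orderedSum` in which the factor `b + ∑ i ∈ U, a i` is included. -/
def orderedSumFull (a : ι → R) (b : R) (U : Finset ι) : R :=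
  (b + ∑ i ∈ U, a i) * orderedSum a b U

theorem orderedSum_empty (a : ι → R) (b : R) : orderedSum a b ∅ = 1 := by
  rw [orderedSum, if_pos rfl]

theorem sum_orderedSumFull_erase (a : ι → R) (b : R) {U : Finset ι} (hU : U.Nonempty) :
    ∑ s ∈ U, orderedSumFull a b (U.erase s) = orderedSum a b U := by
  rw [orderedSum, if_neg hU.ne_empty, ← Finset.sum_attach]
  rfl

theorem erase_sdiff_erase_of_mem (S : Finset ι) {U : Finset ι} {s : ι} (hs : s ∈ U) :
    S.erase s \ U.erase s = S \ U := by
  ext x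
  by_cases hx : x = s
  · simp [hx, hs]
  · simp [hx]

theorem sum_powerset_erase_eq_sum_sdiff {M : Type*} [AddCommMonoid M] (S : Finset ι)
    (F : ι → Finset ι → M) :
    ∑ s ∈ S, ∑ U ∈ (S.erase s).powerset, F s U = ∑ U ∈ S.powerset, ∑ s ∈ S \ U, F s U := by
  apply Finset.sum_comm'
  intro s U
  simp only [Finset.mem_powerset, Finset.mem_sdiff, Finset.subset_erase]
  tauto

theorem sum_powerset_erase_eq_sum_mem {M : Type*} [AddCommMonoid M] (S : Finset ι)
    (F : ι → Finset ι → M) :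
    ∑ s ∈ S, ∑ U ∈ (S.erase s).powerset, F s U
      = ∑ U ∈ S.powerset, ∑ s ∈ U, F s (U.erase s) := by
  have h : ∀ s ∈ S, ∑ U ∈ (S.erase s).powerset, F s U
      = ∑ U ∈ S.powerset with s ∈ U, F s (U.erase s) := by
    intro s hs
    refine Finset.sum_bij' (fun U _ => insert s U) (fun U _ => U.erase s) ?_ ?_ ?_ ?_ ?_
    · intro U hU
      simp only [Finset.mem_powerset, Finset.subset_erase] at hU
      simp [Finset.insert_subset_iff, hs, hU.1]
    · intro U hU
      simp only [Finset.mem_filter, Finset.mem_powerset] at hU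
      simpa using Finset.erase_subset_erase s hU.1
    · intro U hU
      simp only [Finset.mem_powerset, Finset.subset_erase] at hU
      exact Finset.erase_insert hU.2
    · intro U hU
      exact Finset.insert_erase (Finset.mem_filter.1 hU).2
    · intro U hU
      simp only [Finset.mem_powerset, Finset.subset_erase] at hU
      rw [Finset.erase_insert hU.2]
  rw [Finset.sum_congr rfl h]
  apply Finset.sum_comm'
  intro s U
  simp only [Finset.mem_filter, Finset.mem_powerset]
  exact ⟨fun h => ⟨h.2.2, h.2.1⟩, fun h => ⟨h.2 h.1, h.2, h.1⟩⟩

theorem add_add_sum_mul_orderedSum (a : ι → R) (b c : R) {S U : Finset ι} (hU : U ⊆ S) :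
    (b + c + ∑ i ∈ S, a i) * (orderedSum a b U * orderedSum a c (S \ U))
      = orderedSumFull a b U * orderedSum a c (S \ U)
        + orderedSum a b U * orderedSumFull a c (S \ U) := by
  rw [orderedSumFull, orderedSumFull, ← Finset.sum_sdiff hU]
  ring

theorem orderedSum_add (a : ι → R) (b c : R) (S : Finset ι) :
    orderedSum a (b + c) S
      = ∑ U ∈ S.powerset,
          (S.card.choose U.card : R) * (orderedSum a b U * orderedSum a c (S \ U)) := by
  induction S using Finset.strongInduction with
  | H S ih =>
  rcases S.eq_empty_or_nonempty with rfl | hS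
  · simp [orderedSum_empty]
  obtain ⟨m, hm⟩ : ∃ m, S.card = m + 1 := Nat.exists_eq_succ_of_ne_zero hS.card_pos.ne'
  have key : ∀ s ∈ S, orderedSumFull a (b + c) (S.erase s)
      = ∑ U ∈ (S.erase s).powerset, (m.choose U.card : R) *
          (orderedSumFull a b U * orderedSum a c (S.erase s \ U))
        + ∑ U ∈ (S.erase s).powerset, (m.choose U.card : R) *
          (orderedSum a b U * orderedSumFull a c (S.erase s \ U)) := by
    intro s hs
    rw [orderedSumFull, ih _ (Finset.erase_ssubset hs), Finset.mul_sum, ← Finset.sum_add_distrib,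
      Finset.card_erase_of_mem hs, hm, Nat.add_sub_cancel]
    refine Finset.sum_congr rfl fun U hU => ?_
    rw [← mul_add, ← add_add_sum_mul_orderedSum a b c (Finset.mem_powerset.1 hU)]
    ring
  rw [← sum_orderedSumFull_erase a _ hS, Finset.sum_congr rfl key, Finset.sum_add_distrib,
    sum_powerset_erase_eq_sum_mem, sum_powerset_erase_eq_sum_sdiff, ← Finset.sum_add_distrib]
  refine Finset.sum_congr rfl fun U hU => ?_
  rw [Finset.mem_powerset] at hU
  have h₁ : ∑ s ∈ U, (m.choose (U.erase s).card : R) *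
      (orderedSumFull a b (U.erase s) * orderedSum a c (S.erase s \ U.erase s))
      = ((m + 1).choose U.card - m.choose U.card : R) *
        (orderedSum a b U * orderedSum a c (S \ U)) := by
    rcases U.eq_empty_or_nonempty with rfl | hne
    · simp
    obtain ⟨k, hk⟩ : ∃ k, U.card = k + 1 := Nat.exists_eq_succ_of_ne_zero hne.card_pos.ne'
    rw [← sum_orderedSumFull_erase a b hne, Finset.sum_mul, Finset.mul_sum]
    refine Finset.sum_congr rfl fun s hs => ?_
    rw [erase_sdiff_erase_of_mem S hs, Finset.card_erase_of_mem hs, hk, Nat.add_sub_cancel, Nat.choose_succ_succ]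
    push_cast
    ring
  have h₂ : ∑ s ∈ S \ U, (m.choose U.card : R) *
      (orderedSum a b U * orderedSumFull a c (S.erase s \ U))
      = (m.choose U.card : R) * (orderedSum a b U * orderedSum a c (S \ U)) := by
    rcases (S \ U).eq_empty_or_nonempty with he | hne
    · have : U = S := hU.antisymm (Finset.sdiff_eq_empty_iff_subset.1 he)
      subst this
      simp [hm]
    rw [← sum_orderedSumFull_erase a c hne, Finset.mul_sum, Finset.mul_sum]
    refine Finset.sum_congr rfl fun s hs => ?_
    rw [Finset.erase_sdiff_comm]
  rw [h₁, h₂, hm]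
  ring

theorem orderedSumFull_add {p : ℕ} (hp : p.Prime) [CharP R p] (a : ι → R) (b c : R)
    {S : Finset ι} (hS : S.card + 1 = p) :
    orderedSumFull a (b + c) S = orderedSumFull a b S + orderedSumFull a c S := by
  have hsplit : ∀ (x : R) (U : Finset ι), orderedSum a x U
      = ∑ s ∈ U, orderedSumFull a x (U.erase s) + if U = ∅ then 1 else 0 := by
    intro x U
    rcases U.eq_empty_or_nonempty with rfl | hne
    · simp [orderedSum_empty]
    · simp [sum_orderedSumFull_erase a x hne, hne.ne_empty]
  have hexp : orderedSumFull a (b + c) S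
      = ∑ U ∈ S.powerset, (S.card.choose U.card : R) *
          (orderedSumFull a b U * orderedSum a c (S \ U))
        + ∑ U ∈ S.powerset, (S.card.choose U.card : R) *
          (orderedSum a b U * orderedSumFull a c (S \ U)) := by
    rw [orderedSumFull, orderedSum_add, Finset.mul_sum, ← Finset.sum_add_distrib]
    refine Finset.sum_congr rfl fun U hU => ?_
    rw [← mul_add, ← add_add_sum_mul_orderedSum a b c (Finset.mem_powerset.1 hU)]
    ring
  have h₁ : ∑ U ∈ S.powerset, (S.card.choose U.card : R) *
        (orderedSumFull a b U * orderedSum a c (S \ U))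
      = ∑ s ∈ S, ∑ U ∈ (S.erase s).powerset, (S.card.choose U.card : R) *
          (orderedSumFull a b U * orderedSumFull a c (S.erase s \ U))
        + orderedSumFull a b S := by
    rw [sum_powerset_erase_eq_sum_sdiff]
    simp_rw [hsplit c, mul_add, Finset.sum_add_distrib, Finset.mul_sum, Finset.erase_sdiff_comm]
    congr 1
    rw [Finset.sum_eq_single_of_mem S (Finset.mem_powerset_self S)]
    · simp
    · intro U hU hne
      rw [if_neg, mul_zero, mul_zero]
      rw [Finset.sdiff_eq_empty_iff_subset]
      exact fun h => hne ((Finset.mem_powerset.1 hU).antisymm h)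
  have h₂ : ∑ U ∈ S.powerset, (S.card.choose U.card : R) *
        (orderedSum a b U * orderedSumFull a c (S \ U))
      = ∑ s ∈ S, ∑ U ∈ (S.erase s).powerset, (S.card.choose (U.card + 1) : R) *
          (orderedSumFull a b U * orderedSumFull a c (S.erase s \ U))
        + orderedSumFull a c S := by
    rw [sum_powerset_erase_eq_sum_mem]
    simp_rw [hsplit b, add_mul, mul_add, Finset.sum_add_distrib, Finset.sum_mul, Finset.mul_sum]
    congr 1
    · refine Finset.sum_congr rfl fun U hU => Finset.sum_congr rfl fun s hs => ?_
      rw [erase_sdiff_erase_of_mem S hs, Finset.card_erase_add_one hs]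
    · rw [Finset.sum_eq_single_of_mem ∅ (Finset.empty_mem_powerset S)]
      · simp
      · intro U hU hne
        simp [hne]
  have h₀ : ∑ s ∈ S, ∑ U ∈ (S.erase s).powerset, (S.card.choose U.card : R) *
          (orderedSumFull a b U * orderedSumFull a c (S.erase s \ U))
      + ∑ s ∈ S, ∑ U ∈ (S.erase s).powerset, (S.card.choose (U.card + 1) : R) *
          (orderedSumFull a b U * orderedSumFull a c (S.erase s \ U)) = 0 := by
    rw [← Finset.sum_add_distrib]
    refine Finset.sum_eq_zero fun s hs => ?_
    rw [← Finset.sum_add_distrib]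
    refine Finset.sum_eq_zero fun U hU => ?_
    have hlt : U.card + 1 < p := by
      have := Finset.card_le_card (Finset.mem_powerset.1 hU)
      rw [Finset.card_erase_of_mem hs] at this
      have := Finset.card_pos.2 ⟨s, hs⟩
      omega
    rw [← add_mul, ← Nat.cast_add, ← Nat.choose_succ_succ', hS,
      (CharP.cast_eq_zero_iff R p _).2 (hp.dvd_choose_self (Nat.succ_ne_zero _) hlt), zero_mul]
  rw [hexp, h₁, h₂]
  linear_combination h₀


theorem map_orderedSum {R' : Type*} [CommRing R'] (φ : R →+* R') (a : ι → R) (b : R)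
    (U : Finset ι) : φ (orderedSum a b U) = orderedSum (fun i => φ (a i)) (φ b) U := by
  induction U using Finset.strongInduction with
  | H U ih =>
  rcases U.eq_empty_or_nonempty with rfl | hU
  · simp [orderedSum_empty]
  rw [← sum_orderedSumFull_erase _ _ hU, ← sum_orderedSumFull_erase _ _ hU, map_sum]
  refine Finset.sum_congr rfl fun s hs => ?_
  simp [orderedSumFull, ih _ (Finset.erase_ssubset hs)]

open Polynomial in
/-- `orderedSumFull` as a polynomial in its starting value. -/
noncomputable def orderedSumPoly (a : ι → R) (U : Finset ι) : R[X] :=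
  orderedSumFull (fun i => C (a i)) X U

open Polynomial in
theorem eval_orderedSumPoly (a : ι → R) (b : R) (U : Finset ι) :
    (orderedSumPoly a U).eval b = orderedSumFull a b U := by
  have h := map_orderedSum (evalRingHom b) (fun i => C (a i)) X U
  simp only [coe_evalRingHom, eval_C, eval_X] at h
  simp [orderedSumPoly, orderedSumFull, h, eval_finsetSum]

open Polynomial in
theorem orderedSumPoly_empty (a : ι → R) : orderedSumPoly a ∅ = X := by
  simp [orderedSumPoly, orderedSumFull, orderedSum_empty]

open Polynomial in
theorem orderedSumPoly_eq (a : ι → R) {U : Finset ι} (hU : U.Nonempty) :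
    orderedSumPoly a U
      = (X + C (∑ i ∈ U, a i)) * ∑ s ∈ U, orderedSumPoly a (U.erase s) := by
  simp only [orderedSumPoly]
  rw [sum_orderedSumFull_erase _ _ hU, orderedSumFull, map_sum]

theorem coeff_zero_orderedSumPoly (a : ι → R) (U : Finset ι) :
    (orderedSumPoly a U).coeff 0 = 0 := by
  rw [Polynomial.coeff_zero_eq_eval_zero, eval_orderedSumPoly]
  induction U using Finset.strongInduction with
  | H U ih =>
  rcases U.eq_empty_or_nonempty with rfl | hU
  · simp [orderedSumFull]
  rw [orderedSumFull, ← sum_orderedSumFull_erase _ _ hU,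
    Finset.sum_eq_zero fun s hs => ih _ (Finset.erase_ssubset hs), mul_zero]

theorem coeff_one_orderedSumPoly (a : ι → R) {U : Finset ι} (hU : U.Nonempty) :
    (orderedSumPoly a U).coeff 1
      = (∑ i ∈ U, a i) * ∑ s ∈ U, (orderedSumPoly a (U.erase s)).coeff 1 := by
  rw [orderedSumPoly_eq a hU, add_mul, Polynomial.coeff_add, Polynomial.coeff_X_mul,
    Polynomial.coeff_C_mul, Polynomial.finsetSum_coeff, Polynomial.finsetSum_coeff,
    Finset.sum_eq_zero fun s _ => coeff_zero_orderedSumPoly a (U.erase s), zero_add]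

theorem natDegree_orderedSumPoly_le (a : ι → R) (U : Finset ι) :
    (orderedSumPoly a U).natDegree ≤ U.card + 1 := by
  induction U using Finset.strongInduction with
  | H U ih =>
  rcases U.eq_empty_or_nonempty with rfl | hU
  · rw [orderedSumPoly_empty]
    exact Polynomial.natDegree_X_le
  rw [orderedSumPoly_eq a hU, add_comm U.card]
  refine Polynomial.natDegree_mul_le_of_le ?_ (Polynomial.natDegree_sum_le_of_forall_le _ _ ?_)
  · exact Polynomial.natDegree_add_le_of_degree_le Polynomial.natDegree_X_le
      ((Polynomial.natDegree_C _).trans_le zero_le_one)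
  · intro s hs
    rw [← Finset.card_erase_add_one hs]
    exact ih _ (Finset.erase_ssubset hs)

theorem coeff_card_add_one_orderedSumPoly (a : ι → R) (U : Finset ι) :
    (orderedSumPoly a U).coeff (U.card + 1) = (U.card.factorial : R) := by
  induction U using Finset.strongInduction with
  | H U ih =>
  rcases U.eq_empty_or_nonempty with rfl | hU
  · simp [orderedSumPoly_empty]
  have h₁ : ∀ s ∈ U, (orderedSumPoly a (U.erase s)).coeff U.card
      = ((U.card - 1).factorial : R) := by
    intro s hs
    rw [← Finset.card_erase_of_mem hs, ← ih _ (Finset.erase_ssubset hs),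
      Finset.card_erase_add_one hs]
  have h₂ : ∀ s ∈ U, (orderedSumPoly a (U.erase s)).coeff (U.card + 1) = 0 := by
    intro s hs
    apply Polynomial.coeff_eq_zero_of_natDegree_lt
    have := natDegree_orderedSumPoly_le a (U.erase s)
    rw [Finset.card_erase_add_one hs] at this
    omega
  rw [orderedSumPoly_eq a hU, add_mul, Polynomial.coeff_add, Polynomial.coeff_X_mul,
    Polynomial.coeff_C_mul, Polynomial.finsetSum_coeff, Polynomial.finsetSum_coeff,
    Finset.sum_congr rfl h₁, Finset.sum_eq_zero h₂, mul_zero, add_zero, Finset.sum_const,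
    nsmul_eq_mul, ← Nat.cast_mul, Nat.mul_factorial_pred hU.card_pos.ne']

open Polynomial in
theorem coeff_one_orderedSumPoly_eq_pow [IsDomain R] {p : ℕ} (hp : p.Prime) [CharP R p]
    (a : ι → R) {S : Finset ι} (hS : S.card + 1 = p) (hT : ∑ i ∈ S, a i ≠ 0) :
    (orderedSumPoly a S).coeff 1 = (∑ i ∈ S, a i) ^ (p - 1) := by
  have : Fact p.Prime := ⟨hp⟩
  set T := ∑ i ∈ S, a i with hTdef
  let K : R →+ R := AddMonoidHom.mk' (fun b => orderedSumFull a b S)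
    fun b c => orderedSumFull_add hp a b c hS
  have hK : K T = 0 := by
    have : K (-T) = 0 := by simp [K, orderedSumFull, hTdef]
    simpa using this
  let Q : R[X] := orderedSumPoly a S + X ^ p - C (T ^ (p - 1)) * X
  have hfact : (S.card.factorial : R) = -1 := by
    have h := congrArg (ZMod.castHom dvd_rfl R) (ZMod.wilsons_lemma p)
    rw [show p - 1 = S.card by omega] at h
    simpa using h
  have hdeg : Q.natDegree < p := by
    have hle : Q.natDegree ≤ p := by
      refine (natDegree_sub_le_of_le (natDegree_add_le_of_degree_le ?_ (natDegree_X_pow_le p))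
        ((natDegree_C_mul_le _ _).trans (natDegree_X_le.trans hp.one_lt.le))).trans (max_self p).le
      exact hS ▸ natDegree_orderedSumPoly_le a S
    have hc : Q.coeff p = 0 := by
      have h := coeff_card_add_one_orderedSumPoly a S
      rw [hS, hfact] at h
      simp [Q, h, coeff_X, hp.one_lt.ne, coeff_C_mul, -map_pow]
    refine lt_of_le_of_ne hle fun he => ?_
    have hQ : Q = 0 := leadingCoeff_eq_zero.1 (by rw [leadingCoeff, he, hc])
    rw [hQ, natDegree_zero] at he
    exact hp.ne_zero he.symm
  have hQ : Q = 0 := by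
    refine eq_zero_of_natDegree_lt_card_of_eval_eq_zero Q (f := fun j : Fin p => (j : R) * T)
      ?_ ?_ (by simpa using hdeg)
    · intro i j hij
      exact Fin.ext (CharP.natCast_injOn_Iio R p i.2 j.2 (mul_right_cancel₀ hT hij))
    · intro j
      have hj : orderedSumFull a ((j : R) * T) S = 0 := by
        have h := map_nsmul K (j : ℕ) T
        rw [hK, smul_zero, nsmul_eq_mul] at h
        exact h
      have hfrob : ((j : ℕ) : R) ^ p = (j : ℕ) := map_natCast (frobenius R p) j
      have hpow : T ^ p = T ^ (p - 1) * T := (pow_sub_one_mul hp.ne_zero T).symm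
      simp only [Q, eval_sub, eval_add, eval_orderedSumPoly, hj, eval_pow, eval_X, eval_mul,
        eval_C, mul_pow, hfrob, hpow]
      ring
  have h1 : Q.coeff 1 = 0 := by rw [hQ, coeff_zero]
  simp only [Q, coeff_sub, coeff_add, coeff_X_pow, coeff_C_mul, coeff_X_one, mul_one,
    if_neg hp.one_lt.ne, add_zero] at h1
  exact sub_eq_zero.1 h1

end OrderedSum

section DiffProd

variable {ι k A : Type*} [CommRing k] [CommRing A] [Algebra k A]

open MvPolynomial

/-- The linear map sending the monomial `∏ i, X i ^ m i` to `∏ i ∈ U, D^[m i] (f i)`. -/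
noncomputable def diffProd (D : Derivation k A A) (f : ι → A) (U : Finset ι) :
    MvPolynomial ι k →ₗ[k] A :=
  (basisMonomials ι k).constr k fun m => ∏ i ∈ U, D^[m i] (f i)

theorem diffProd_monomial (D : Derivation k A A) (f : ι → A) (U : Finset ι) (m : ι →₀ ℕ)
    (c : k) : diffProd D f U (monomial m c) = c • ∏ i ∈ U, D^[m i] (f i) := by
  have h : monomial m c = c • basisMonomials ι k m := by simp [smul_monomial]
  rw [h, map_smul, diffProd, Module.Basis.constr_basis]

theorem diffProd_one (D : Derivation k A A) (f : ι → A) (U : Finset ι) :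
    diffProd D f U 1 = ∏ i ∈ U, f i := by
  simpa using diffProd_monomial D f U 0 1

variable [DecidableEq ι]

theorem Derivation.apply_prod (D : Derivation k A A) (g : ι → A) (U : Finset ι) :
    D (∏ i ∈ U, g i) = ∑ i ∈ U, D (g i) * ∏ j ∈ U.erase i, g j := by
  induction U using Finset.induction_on with
  | empty => simp
  | insert s U hs ih =>
    rw [Finset.prod_insert hs, D.leibniz, ih, Finset.sum_insert hs, Finset.erase_insert hs,
      smul_eq_mul, smul_eq_mul, add_comm, mul_comm, Finset.mul_sum]
    congr 1
    refine Finset.sum_congr rfl fun i hi => ?_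
    have hne : s ≠ i := fun h => hs (h ▸ hi)
    rw [Finset.erase_insert_of_ne hne,
      Finset.prod_insert fun h => hs (Finset.mem_of_mem_erase h)]
    ring

theorem deriv_diffProd (D : Derivation k A A) (f : ι → A) (U : Finset ι)
    (P : MvPolynomial ι k) :
    D (diffProd D f U P) = diffProd D f U ((∑ i ∈ U, X i) * P) := by
  induction P using MvPolynomial.induction_on' with
  | add P Q hP hQ => rw [map_add, map_add, hP, hQ, mul_add, map_add]
  | monomial m c =>
    rw [diffProd_monomial, D.map_smul, D.apply_prod, Finset.sum_mul, map_sum, Finset.smul_sum]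
    refine Finset.sum_congr rfl fun i hi => ?_
    rw [X, monomial_mul, one_mul, diffProd_monomial, ← Finset.mul_prod_erase U _ hi]
    congr 2
    · rw [← Function.iterate_succ_apply' D]
      simp [add_comm]
    · refine Finset.prod_congr rfl fun j hj => ?_
      simp [Finsupp.single_eq_of_ne (Finset.ne_of_mem_erase hj)]

theorem iterate_deriv_diffProd (D : Derivation k A A) (f : ι → A) (U : Finset ι) (n : ℕ)
    (P : MvPolynomial ι k) :
    D^[n] (diffProd D f U P) = diffProd D f U ((∑ i ∈ U, X i) ^ n * P) := by
  induction n with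
  | zero => simp
  | succ n ih => rw [Function.iterate_succ_apply', ih, deriv_diffProd, pow_succ', mul_assoc]

theorem mul_diffProd_erase (D : Derivation k A A) (f : ι → A) {U : Finset ι} {s : ι}
    (hs : s ∈ U) {P : MvPolynomial ι k} (hP : s ∉ P.vars) :
    f s * diffProd D f (U.erase s) P = diffProd D f U P := by
  rw [P.as_sum, map_sum, map_sum, Finset.mul_sum]
  refine Finset.sum_congr rfl fun m hm => ?_
  have hms : m s = 0 := by
    by_contra h
    exact hP ((mem_vars_iff_mem_support s).2 ⟨m, hm, Finsupp.mem_support_iff.2 h⟩)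
  rw [diffProd_monomial, diffProd_monomial, mul_smul_comm, ← Finset.mul_prod_erase U _ hs, hms]
  rfl

theorem vars_coeff_one_orderedSumPoly_subset [Nontrivial k] (U : Finset ι) :
    ((orderedSumPoly (X : ι → MvPolynomial ι k) U).coeff 1).vars ⊆ U := by
  induction U using Finset.strongInduction with
  | H U ih =>
  rcases U.eq_empty_or_nonempty with rfl | hU
  · simp [orderedSumPoly_empty]
  rw [coeff_one_orderedSumPoly _ hU]
  refine (vars_mul _ _).trans (Finset.union_subset ?_ ?_)
  · refine (vars_sum_subset _ _).trans (Finset.biUnion_subset.2 fun i hi => ?_)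
    rwa [vars_X, Finset.singleton_subset_iff]
  · refine (vars_sum_subset _ _).trans (Finset.biUnion_subset.2 fun s hs => ?_)
    exact (ih _ (Finset.erase_ssubset hs)).trans (Finset.erase_subset s U)

variable [Fintype ι]

/-- The sum of the words `D (f (e (m - 1)) * ⋯ * D (f (e 0)))` over all injections `e` from
`Fin m` to `U`. -/
def wordSum (D : A → A) (f : ι → A) (m : ℕ) (U : Finset ι) : A :=
  ∑ e : Fin m → ι with Function.Injective e ∧ ∀ i, e i ∈ U,
    (List.ofFn fun i => f (e i)).foldl (fun u a => D (a * u)) 1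

theorem wordSum_zero (D : A → A) (f : ι → A) (U : Finset ι) : wordSum D f 0 U = 1 := by
  simp [wordSum, Function.injective_of_subsingleton]

theorem wordSum_succ (D : Derivation k A A) (f : ι → A) (m : ℕ) (U : Finset ι) :
    wordSum D f (m + 1) U = D (∑ s ∈ U, f s * wordSum D f m (U.erase s)) := by
  simp only [wordSum, map_sum, Finset.mul_sum]
  rw [Finset.sum_sigma']
  refine Finset.sum_bij' (fun e _ => ⟨e (Fin.last m), Fin.init e⟩)
    (fun x _ => Fin.snoc (α := fun _ => ι) x.2 x.1) ?_ ?_ ?_ ?_ ?_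
  · intro e he
    simp only [Finset.mem_filter, Finset.mem_univ, true_and] at he
    simp only [Finset.mem_sigma, Finset.mem_filter, Finset.mem_univ, true_and, Finset.mem_erase]
    refine ⟨he.2 _, fun i j hij => Fin.castSucc_injective m (he.1 hij), fun i => ⟨?_, he.2 _⟩⟩
    exact fun h => (Fin.castSucc_lt_last i).ne (he.1 h)
  · rintro ⟨s, e⟩ he
    simp only [Finset.mem_sigma, Finset.mem_filter, Finset.mem_univ, true_and,
      Finset.mem_erase] at he
    simp only [Finset.mem_filter, Finset.mem_univ, true_and]
    refine ⟨Fin.snoc_injective_iff.2 ⟨he.2.1, ?_⟩, fun i => ?_⟩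
    · rintro ⟨i, hi⟩
      exact (he.2.2 i).1 hi
    · refine Fin.lastCases ?_ (fun i => ?_) i
      · simpa using he.1
      · simpa using (he.2.2 i).2
  · intro e _
    simp
  · rintro ⟨s, e⟩ _
    simp
  · intro e _
    rw [List.ofFn_succ', List.concat_eq_append, List.foldl_append]
    rfl

theorem wordSum_card [Nontrivial k] (D : Derivation k A A) (f : ι → A) (U : Finset ι) :
    wordSum D f U.card U
      = diffProd D f U ((orderedSumPoly (X : ι → MvPolynomial ι k) U).coeff 1) := by
  induction U using Finset.strongInduction with
  | H U ih =>
  rcases U.eq_empty_or_nonempty with rfl | hU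
  · simp [orderedSumPoly_empty, wordSum_zero, diffProd_one]
  obtain ⟨m, hm⟩ : ∃ m, U.card = m + 1 := Nat.exists_eq_succ_of_ne_zero hU.card_pos.ne'
  rw [coeff_one_orderedSumPoly _ hU, ← deriv_diffProd, hm, wordSum_succ, map_sum (diffProd D f U)]
  congr 1
  refine Finset.sum_congr rfl fun s hs => ?_
  rw [← mul_diffProd_erase D f hs fun h => Finset.notMem_erase s U
    (vars_coeff_one_orderedSumPoly_subset _ h), ← ih _ (Finset.erase_ssubset hs),
    Finset.card_erase_of_mem hs, hm, Nat.add_sub_cancel]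

end DiffProd

theorem sum_perm_eq_wordSum {A : Type*} [CommRing A] (D : A → A) {n : ℕ} (f : Fin n → A) :
    ∑ σ : Equiv.Perm (Fin n), (List.ofFn fun i => f (σ i)).foldl (fun u a => D (a * u)) 1
      = wordSum D f n Finset.univ := by
  refine Finset.sum_bij (fun σ _ => σ) ?_ ?_ ?_ ?_
  · intro σ _
    simp [σ.injective]
  · intro σ _ τ _ h
    exact DFunLike.coe_injective h
  · intro e he
    simp only [Finset.mem_filter, Finset.mem_univ, true_and] at he
    exact ⟨Equiv.ofBijective e (Finite.injective_iff_bijective.1 he.1), Finset.mem_univ _, rfl⟩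
  · intro σ _
    rfl

theorem sum_perm_words_eq_iterated_deriv_of_prod (p : ℕ) (hp : p.Prime)
    (A : Type*) [CommRing A] [CharP A p]
    (D : A → A) (hadd : ∀ a b : A, D (a + b) = D a + D b)
    (hleib : ∀ a b : A, D (a * b) = a * D b + b * D a)
    (f : Fin (p - 1) → A) :
    ∑ σ : Equiv.Perm (Fin (p - 1)),
        (List.ofFn fun i : Fin (p - 1) => f (σ i)).foldl (fun u a => D (a * u)) 1
      = D^[p - 1] (∏ i : Fin (p - 1), f i) := by
  have : Fact p.Prime := ⟨hp⟩
  let _ : Algebra (ZMod p) A := ZMod.algebra A p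
  let D' : Derivation (ZMod p) A A :=
    Derivation.mk' ((AddMonoidHom.mk' D hadd).toZModLinearMap p) hleib
  have hcard : (Finset.univ : Finset (Fin (p - 1))).card = p - 1 := by simp
  have hpos : 0 < p - 1 := Nat.sub_pos_of_lt hp.one_lt
  have hT : ∑ i : Fin (p - 1), (MvPolynomial.X i : MvPolynomial _ (ZMod p)) ≠ 0 := by
    intro h
    have hc := congrArg (MvPolynomial.coeff (Finsupp.single ⟨0, hpos⟩ 1)) h
    simp [MvPolynomial.coeff_sum, MvPolynomial.coeff_X, Finsupp.single_left_inj] at hc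
  have hword := wordSum_card D' f Finset.univ
  rw [coeff_one_orderedSumPoly_eq_pow hp _ (by rw [hcard]; omega) hT, hcard] at hword
  have hiter := iterate_deriv_diffProd D' f Finset.univ (p - 1) 1
  rw [diffProd_one, mul_one, ← hword] at hiter
  rw [sum_perm_eq_wordSum]
  exact hiter.symm
end
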